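/- arXiv:2404.05756 — 3 statements merged into one kernel-verified Lean document; each statement's English description precedes it below -/
import Mathlib

section
/- For every τ ∈ ℍ, one has I(τ)·(1 + I(τ)J(τ)) = J(τ)²·(I(τ)³ + J(τ)). -/
open Complex

/-- The `q`-Pochhammer infinite product `(a; q)∞ = ∏_{n=0}^∞ (1 - a qⁿ)`. -/
noncomputable def qPoch (a q : ℂ) : ℂ := ∏' n : ℕ, (1 - a * q ^ n)

/-- The nome `q = e^{2πiτ}` of a point `τ` of the upper half-plane. -/
noncomputable def Qc (τ : UpperHalfPlane) : ℂ := Complex.exp (2 * Real.pi * Complex.I * τ)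


/-- `I(τ) = q^{3/4}(q;q¹⁰)∞(q⁹;q¹⁰)∞ / ((q⁴;q¹⁰)∞(q⁶;q¹⁰)∞)` with `q^{3/4} = e^{2πiτ·(3/4)}`. -/
noncomputable def Ifun (τ : UpperHalfPlane) : ℂ :=
  Complex.exp (2 * Real.pi * Complex.I * τ * (3 / 4)) *
    (qPoch (Qc τ) (Qc τ ^ 10) * qPoch (Qc τ ^ 9) (Qc τ ^ 10)) /
    (qPoch (Qc τ ^ 4) (Qc τ ^ 10) * qPoch (Qc τ ^ 6) (Qc τ ^ 10))

/-- `J(τ) = q^{1/4}(q²;q¹⁰)∞(q⁸;q¹⁰)∞ / ((q³;q¹⁰)∞(q⁷;q¹⁰)∞)` with `q^{1/4} = e^{2πiτ·(1/4)}`. -/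
noncomputable def Jfun (τ : UpperHalfPlane) : ℂ :=
  Complex.exp (2 * Real.pi * Complex.I * τ * (1 / 4)) *
    (qPoch (Qc τ ^ 2) (Qc τ ^ 10) * qPoch (Qc τ ^ 8) (Qc τ ^ 10)) /
    (qPoch (Qc τ ^ 3) (Qc τ ^ 10) * qPoch (Qc τ ^ 7) (Qc τ ^ 10))

open Filter Topology

namespace ThetaAux

lemma summable_quad {r s : ℂ} (hr0 : r ≠ 0) (hr : ‖r‖ < 1) (hs : s ≠ 0) :
    Summable (fun n : ℤ => r ^ (n * n) * s ^ n) := by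
  have hpi : (Real.pi : ℂ) ≠ 0 := by exact_mod_cast Real.pi_ne_zero
  have h1 : 0 < (Complex.log r / (Real.pi * Complex.I)).im := by
    have : Complex.log r / (Real.pi * Complex.I) = ((1 / Real.pi : ℝ) : ℂ) * (-Complex.I * Complex.log r) := by
      push_cast
      field_simp
      rw [Complex.I_sq]; ring
    rw [this, Complex.im_ofReal_mul]
    have h2 : (-Complex.I * Complex.log r).im = - Real.log ‖r‖ := by
      simp [Complex.log_re]
    rw [h2]
    have := Real.log_neg (norm_pos_iff.mpr hr0) hr
    have := Real.pi_pos
    apply mul_pos (by positivity) (by linarith)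
  have h3 := (summable_jacobiTheta₂_term_iff (Complex.log s / (2 * Real.pi * Complex.I)) _).mpr h1
  refine h3.congr (fun n => ?_)
  rw [jacobiTheta₂_term]
  have e1 : 2 * (Real.pi : ℂ) * Complex.I * n * (Complex.log s / (2 * Real.pi * Complex.I)) = n * Complex.log s := by
    field_simp
  have e2 : (Real.pi : ℂ) * Complex.I * n ^ 2 * (Complex.log r / (Real.pi * Complex.I)) = ((n * n : ℤ) : ℂ) * Complex.log r := by
    push_cast; field_simp
  rw [e1, e2, Complex.exp_add, Complex.exp_int_mul, Complex.exp_int_mul, Complex.exp_log hr0, Complex.exp_log hs, mul_comm]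

/-- theta term -/
noncomputable def st (r z : ℂ) (n : ℤ) : ℂ := (-1) ^ n * r ^ (n * n - n) * z ^ n

lemma st_eq {r z : ℂ} (hr0 : r ≠ 0) (n : ℤ) : st r z n = r ^ (n * n) * (-z / r) ^ n := by
  rw [st, zpow_sub₀ hr0, div_zpow, neg_eq_neg_one_mul z, mul_zpow]
  ring

lemma summable_st {r z : ℂ} (hr0 : r ≠ 0) (hr : ‖r‖ < 1) (hz : z ≠ 0) : Summable (st r z) := by
  refine (summable_quad hr0 hr (s := -z / r) (by simp [hz, hr0])).congr (fun n => ?_)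
  rw [st_eq hr0]

lemma st_succ {r z : ℂ} (hr0 : r ≠ 0) (hz : z ≠ 0) (n : ℤ) :
    st r z (n + 1) = -z * r ^ (2 * n) * st r z n := by
  rw [st, st, zpow_add_one₀ (by norm_num), zpow_add_one₀ hz,
    show (n + 1) * (n + 1) - (n + 1) = 2 * n + (n * n - n) by ring, zpow_add₀ hr0]
  ring

noncomputable def PP (r : ℂ) (n : ℕ) : ℂ := ∏ k ∈ Finset.range n, (1 - r ^ 2 * (r ^ 2) ^ k)

noncomputable def iP (r : ℂ) (n : ℤ) : ℂ := if n < 0 then 0 else (PP r n.toNat)⁻¹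

lemma pow_ne {w : ℂ} (hw : ‖w‖ < 1) : 1 - w ≠ 0 := by
  intro h
  have : w = 1 := (sub_eq_zero.mp h).symm
  rw [this] at hw; simp at hw

lemma norm_sq_lt {r : ℂ} (hr : ‖r‖ < 1) : ‖r ^ 2‖ < 1 := by
  rw [norm_pow]; exact pow_lt_one₀ (norm_nonneg _) hr (by norm_num)

lemma fac_lt {a p : ℂ} (ha : ‖a‖ < 1) (hp : ‖p‖ < 1) (k : ℕ) : ‖a * p ^ k‖ < 1 := by
  rw [norm_mul, norm_pow]
  calc ‖a‖ * ‖p‖ ^ k ≤ ‖a‖ * 1 := by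
        gcongr; exact pow_le_one₀ (norm_nonneg _) hp.le
    _ < 1 := by simpa using ha

lemma PP_ne {r : ℂ} (hr : ‖r‖ < 1) (n : ℕ) : PP r n ≠ 0 := by
  rw [PP, Finset.prod_ne_zero_iff]
  intro k _
  exact pow_ne (fac_lt (norm_sq_lt hr) (norm_sq_lt hr) k)

lemma iP_step {r : ℂ} (hr : ‖r‖ < 1) (n : ℤ) :
    iP r n = (1 - r ^ (2 * (n + 1))) * iP r (n + 1) := by
  unfold iP
  rcases lt_trichotomy n (-1) with h | h | h
  · rw [if_pos (by omega), if_pos (by omega)]; simp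
  · subst h; simp
  · obtain ⟨m, rfl⟩ := Int.eq_ofNat_of_zero_le (show 0 ≤ n by omega)
    rw [if_neg (by omega), if_neg (by omega)]
    have : ((m : ℤ) + 1).toNat = m + 1 := by omega
    rw [this, Int.toNat_natCast]
    have h1 := PP_ne hr m
    have h2 := PP_ne hr (m + 1)
    have h3 : PP r (m + 1) = PP r m * (1 - r ^ (2 * ((m : ℤ) + 1))) := by
      rw [PP, Finset.prod_range_succ, ← PP]
      congr 2
      have : (2 * ((m : ℤ) + 1)) = ((2 + 2 * m : ℕ) : ℤ) := by push_cast; ring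
      rw [this, zpow_natCast, pow_add, pow_mul]
    rw [h3] at h2 ⊢
    have h4 := right_ne_zero_of_mul h2
    field_simp

noncomputable def ff (r z : ℂ) (M N : ℕ) (n : ℤ) : ℂ :=
  st r z n * (PP r (M + N) * iP r (N + n) * iP r (M - n))

noncomputable def fp (a p : ℂ) (M : ℕ) : ℂ := ∏ k ∈ Finset.range M, (1 - a * p ^ k)

lemma PP_succ' (r : ℂ) (m : ℕ) : PP r (m + 1) = PP r m * (1 - r ^ (2 * ((m : ℤ) + 1))) := by
  rw [PP, Finset.prod_range_succ, ← PP]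
  congr 2
  have : (2 * ((m : ℤ) + 1)) = ((2 + 2 * m : ℕ) : ℤ) := by push_cast; ring
  rw [this, zpow_natCast, pow_add, pow_mul]

lemma ff_M {r z : ℂ} (hr0 : r ≠ 0) (hr : ‖r‖ < 1) (hz : z ≠ 0) (M N : ℕ) (n : ℤ) :
    ff r z (M + 1) N n = ff r z M N n - z * (r ^ 2) ^ M * ff r z M N (n - 1) := by
  unfold ff
  have h1 := iP_step hr (M - n)
  have h2 := iP_step hr (N + (n - 1))
  have h3 := st_succ hr0 hz (n - 1)
  rw [show (N : ℤ) + (n - 1) + 1 = N + n by ring] at h2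
  rw [show n - 1 + 1 = n by ring] at h3
  rw [show (M : ℤ) - (n - 1) = M - n + 1 by ring, h1, h2, h3,
    show M + 1 + N = (M + N) + 1 by ring, PP_succ']
  push_cast
  rw [show (M : ℤ) + 1 - n = M - n + 1 by ring]
  have e1 : (r ^ 2) ^ M = r ^ (2 * ((M : ℤ) - n + 1)) * r ^ (2 * (n - 1)) := by
    rw [← pow_mul, ← zpow_natCast, ← zpow_add₀ hr0]
    congr 1; push_cast; ring
  have e2 : r ^ (2 * ((M : ℤ) + N + 1)) = r ^ (2 * ((M : ℤ) - n + 1)) * r ^ (2 * (N + n : ℤ)) := by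
    rw [← zpow_add₀ hr0]
    congr 1; ring
  rw [e1, e2]
  ring

lemma ff_N {r z : ℂ} (hr0 : r ≠ 0) (hr : ‖r‖ < 1) (hz : z ≠ 0) (M N : ℕ) (n : ℤ) :
    ff r z M (N + 1) n = ff r z M N n - r ^ 2 / z * (r ^ 2) ^ N * ff r z M N (n + 1) := by
  unfold ff
  have h1 := iP_step hr (M - (n + 1))
  have h2 := iP_step hr (N + n)
  have h3 := st_succ hr0 hz n
  rw [show (M : ℤ) - (n + 1) + 1 = M - n by ring] at h1
  rw [h3, h1, h2, show (N : ℤ) + (n + 1) = N + n + 1 by ring,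
    show M + (N + 1) = (M + N) + 1 by ring, PP_succ']
  push_cast
  rw [show (N : ℤ) + 1 + n = N + n + 1 by ring]
  have e1 : r ^ (2 * ((N : ℤ) + n + 1)) = r ^ 2 * (r ^ 2) ^ N * r ^ (2 * n) := by
    rw [← pow_mul, ← zpow_natCast, ← zpow_natCast, ← zpow_add₀ hr0, ← zpow_add₀ hr0]
    congr 1; push_cast; ring
  have e2 : r ^ (2 * ((M : ℤ) + N + 1)) = r ^ (2 * ((N : ℤ) + n + 1)) * r ^ (2 * (M - n : ℤ)) := by
    rw [← zpow_add₀ hr0]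
    congr 1; ring
  rw [e2, e1]
  field_simp
  ring

lemma hasSum_ff {r z : ℂ} (hr0 : r ≠ 0) (hr : ‖r‖ < 1) (hz : z ≠ 0) (N : ℕ) :
    HasSum (ff r z N N) (fp z (r ^ 2) N * fp (r ^ 2 / z) (r ^ 2) N) := by
  induction N with
  | zero =>
    have h := hasSum_single (f := ff r z 0 0) 0 (by
      intro n hn
      unfold ff iP
      rcases lt_or_gt_of_ne hn with h | h
      · simp [h]
      · simp [h])
    have h0 : ff r z 0 0 0 = 1 := by simp [ff, st, iP, PP]
    rw [h0] at h
    simpa [fp] using h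
  | succ N ih =>
    have s1 : HasSum (ff r z (N + 1) N) (fp z (r ^ 2) (N + 1) * fp (r ^ 2 / z) (r ^ 2) N) := by
      have h1 := ((Equiv.subRight (1 : ℤ)).hasSum_iff).mpr ih
      have h2 := ih.sub (h1.mul_left (z * (r ^ 2) ^ N))
      convert! h2 using 1
      · funext n; exact ff_M hr0 hr hz N N n
      · rw [fp, Finset.prod_range_succ, ← fp]; ring
    have h1 := ((Equiv.addRight (1 : ℤ)).hasSum_iff).mpr s1
    have h2 := s1.sub (h1.mul_left (r ^ 2 / z * (r ^ 2) ^ N))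
    convert! h2 using 1
    · funext n; exact ff_N hr0 hr hz (N + 1) N n
    · rw [fp.eq_1 (r ^ 2 / z), Finset.prod_range_succ, ← fp]; ring

lemma summ_fac (a : ℂ) {p : ℂ} (hp : ‖p‖ < 1) : Summable (fun k : ℕ => ‖-(a * p ^ k)‖) := by
  simp only [norm_neg, norm_mul, norm_pow]
  exact (summable_geometric_of_lt_one (norm_nonneg _) hp).mul_left _

lemma tendsto_fp (a : ℂ) {p : ℂ} (hp : ‖p‖ < 1) :
    Tendsto (fp a p) atTop (𝓝 (qPoch a p)) := by
  have h := (multipliable_one_add_of_summable (summ_fac a hp)).hasProd.tendsto_prod_nat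
  simp only [← sub_eq_add_neg] at h
  exact h

lemma qPoch_ne {a p : ℂ} (ha : ‖a‖ < 1) (hp : ‖p‖ < 1) : qPoch a p ≠ 0 := by
  have h := tprod_one_add_ne_zero_of_summable (f := fun k : ℕ => -(a * p ^ k))
    (fun k => by rw [← sub_eq_add_neg]; exact pow_ne (fac_lt ha hp k)) (summ_fac a hp)
  simp only [← sub_eq_add_neg] at h
  exact h

lemma tendsto_PP {r : ℂ} (hr : ‖r‖ < 1) : Tendsto (PP r) atTop (𝓝 (qPoch (r ^ 2) (r ^ 2))) :=
  tendsto_fp _ (norm_sq_lt hr)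

lemma tendsto_inv {r : ℂ} (hr : ‖r‖ < 1) :
    Tendsto (fun n => (PP r n)⁻¹) atTop (𝓝 (qPoch (r ^ 2) (r ^ 2))⁻¹) :=
  (tendsto_PP hr).inv₀ (qPoch_ne (norm_sq_lt hr) (norm_sq_lt hr))

lemma tendsto_iP {r : ℂ} (hr : ‖r‖ < 1) :
    Tendsto (iP r) atTop (𝓝 (qPoch (r ^ 2) (r ^ 2))⁻¹) := by
  have ht : Tendsto Int.toNat atTop atTop := by
    rw [tendsto_atTop_atTop]
    intro b
    exact ⟨b, fun a ha => by omega⟩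
  refine ((tendsto_inv hr).comp ht).congr' ?_
  filter_upwards [eventually_ge_atTop (0 : ℤ)] with n hn
  simp [iP, not_lt.mpr hn]

lemma bdd_iP {r : ℂ} (hr : ‖r‖ < 1) : ∃ K : ℝ, ∀ n, ‖iP r n‖ ≤ K := by
  obtain ⟨K, hK⟩ := (Metric.isBounded_range_of_tendsto _ (tendsto_inv hr)).exists_norm_le
  refine ⟨K, fun n => ?_⟩
  have h0 := hK _ ⟨0, rfl⟩
  unfold iP
  split_ifs
  · rw [norm_zero]; exact (norm_nonneg _).trans h0
  · exact hK _ ⟨_, rfl⟩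

noncomputable def S (r z : ℂ) : ℂ := ∑' n : ℤ, st r z n

/-- Jacobi triple product, up to a nonzero constant. -/
lemma triple {r z : ℂ} (hr0 : r ≠ 0) (hr : ‖r‖ < 1) (hz : z ≠ 0) :
    qPoch z (r ^ 2) * qPoch (r ^ 2 / z) (r ^ 2) = S r z * (qPoch (r ^ 2) (r ^ 2))⁻¹ := by
  have hC := qPoch_ne (norm_sq_lt hr) (norm_sq_lt hr)
  have hp := norm_sq_lt hr
  have t1 := (tendsto_fp z hp).mul (tendsto_fp (r ^ 2 / z) hp)
  obtain ⟨K, hK⟩ := bdd_iP hr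
  obtain ⟨L, hL⟩ := (Metric.isBounded_range_of_tendsto _ (tendsto_PP hr)).exists_norm_le
  have t2 : Tendsto (fun N : ℕ => ∑' n : ℤ, ff r z N N n) atTop
      (𝓝 (∑' n : ℤ, st r z n * (qPoch (r ^ 2) (r ^ 2))⁻¹)) := by
    apply tendsto_tsum_of_dominated_convergence (bound := fun n => ‖st r z n‖ * (L * K * K))
    · exact (summable_st hr0 hr hz).norm.mul_right _
    · intro n
      unfold ff
      have a0 : Tendsto (fun N : ℕ => N + N) atTop atTop :=
        tendsto_atTop_mono (fun N => Nat.le_add_left N N) tendsto_id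
      have a1 : Tendsto (fun N : ℕ => (N : ℤ) + n) atTop atTop :=
        tendsto_atTop_add_const_right _ _ tendsto_natCast_atTop_atTop
      have a2 : Tendsto (fun N : ℕ => (N : ℤ) - n) atTop atTop := by
        simp only [sub_eq_add_neg]
        exact tendsto_atTop_add_const_right _ _ tendsto_natCast_atTop_atTop
      have := ((((tendsto_PP hr).comp a0).mul ((tendsto_iP hr).comp a1)).mul
        ((tendsto_iP hr).comp a2)).const_mul (st r z n)
      rw [mul_inv_cancel₀ hC, one_mul] at this
      exact this
    · refine Eventually.of_forall (fun N n => ?_)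
      unfold ff
      have hL0 := hL _ ⟨N + N, rfl⟩
      have hL1 : 0 ≤ L := (norm_nonneg _).trans hL0
      have hK1 : 0 ≤ K := (norm_nonneg _).trans (hK 0)
      rw [norm_mul, norm_mul, norm_mul]
      gcongr
      · exact hK _
      · exact hK _
  have t3 := t2.congr (fun N => (hasSum_ff hr0 hr hz N).tsum_eq)
  rw [tsum_mul_right] at t3
  exact tendsto_nhds_unique t1 t3

noncomputable def G (r y : ℂ) : ℂ := ∑' n : ℤ, r ^ (2 * (n * n)) * y ^ (2 * n)
noncomputable def E (r y : ℂ) : ℂ := ∑' n : ℤ, r ^ (2 * (n * n - n)) * y ^ (2 * n)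

lemma summable_G {r y : ℂ} (hr0 : r ≠ 0) (hr : ‖r‖ < 1) (hy : y ≠ 0) :
    Summable (fun n : ℤ => r ^ (2 * (n * n)) * y ^ (2 * n)) := by
  refine (summable_quad (r := r ^ 2) (s := y ^ 2) (by simp [hr0]) (norm_sq_lt hr)
    (by simp [hy])).congr (fun n => ?_)
  rw [zpow_mul r 2, zpow_mul y 2]; norm_cast

lemma summable_E {r y : ℂ} (hr0 : r ≠ 0) (hr : ‖r‖ < 1) (hy : y ≠ 0) :
    Summable (fun n : ℤ => r ^ (2 * (n * n - n)) * y ^ (2 * n)) := by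
  refine (summable_quad (r := r ^ 2) (s := y ^ 2 / r ^ 2) (by simp [hr0]) (norm_sq_lt hr)
    (by simp [hy, hr0])).congr (fun n => ?_)
  rw [div_zpow, mul_sub, zpow_sub₀ hr0, zpow_mul r, zpow_mul y, zpow_mul r 2 n]
  norm_cast
  ring

def parInv (m n : ℤ) : (ℤ × ℤ) ⊕ (ℤ × ℤ) :=
  if (m + n) % 2 = 0 then Sum.inl ((m + n) / 2, (m - n) / 2)
  else Sum.inr ((m + n) / 2, (m - n + 1) / 2)

def parFun : (ℤ × ℤ) ⊕ (ℤ × ℤ) → ℤ × ℤ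
  | Sum.inl u => (u.1 + u.2, u.1 - u.2)
  | Sum.inr u => (u.1 + u.2, u.1 - u.2 + 1)

lemma parInv_even (u v : ℤ) : parInv (u + v) (u - v) = Sum.inl (u, v) := by
  unfold parInv
  rw [if_pos (by omega)]
  congr 2 <;> omega

lemma parInv_odd (u v : ℤ) : parInv (u + v) (u - v + 1) = Sum.inr (u, v) := by
  unfold parInv
  rw [if_neg (by omega)]
  congr 2 <;> omega

lemma parFun_inv (m n : ℤ) : parFun (parInv m n) = (m, n) := by
  unfold parInv
  split_ifs with h
  · simp only [parFun]
    congr 1 <;> omega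
  · simp only [parFun]
    congr 1 <;> omega

/-- parity splitting of `ℤ × ℤ` -/
def par : (ℤ × ℤ) ⊕ (ℤ × ℤ) ≃ ℤ × ℤ where
  toFun := parFun
  invFun := fun m => parInv m.1 m.2
  left_inv := by
    rintro (⟨u, v⟩ | ⟨u, v⟩)
    · exact parInv_even u v
    · exact parInv_odd u v
  right_inv := fun m => parFun_inv m.1 m.2

lemma term_even {r x y : ℂ} (hr0 : r ≠ 0) (hx : x ≠ 0) (hy : y ≠ 0) (u v : ℤ) :
    st r (x * y) (u + v) * st r (x / y) (u - v) =
      (r ^ (2 * (u * u - u)) * x ^ (2 * u)) * (r ^ (2 * (v * v)) * y ^ (2 * v)) := by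
  have hm1 : (-1 : ℂ) ≠ 0 := by norm_num
  unfold st
  rw [div_zpow, mul_zpow]
  have a1 : (-1 : ℂ) ^ (u + v) * (-1) ^ (u - v) = 1 := by
    rw [← zpow_add₀ hm1, show u + v + (u - v) = 2 * u by ring, zpow_mul]; norm_num
  have a2 : r ^ ((u + v) * (u + v) - (u + v)) * r ^ ((u - v) * (u - v) - (u - v))
      = r ^ (2 * (u * u - u)) * r ^ (2 * (v * v)) := by
    rw [← zpow_add₀ hr0, ← zpow_add₀ hr0]; congr 1; ring
  have a3 : x ^ (u + v) * x ^ (u - v) = x ^ (2 * u) := by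
    rw [← zpow_add₀ hx]; congr 1; ring
  have a4 : y ^ (u + v) / y ^ (u - v) = y ^ (2 * v) := by
    rw [← zpow_sub₀ hy]; congr 1; ring
  calc _ = ((-1 : ℂ) ^ (u + v) * (-1) ^ (u - v)) *
        (r ^ ((u + v) * (u + v) - (u + v)) * r ^ ((u - v) * (u - v) - (u - v))) *
        (x ^ (u + v) * x ^ (u - v)) * (y ^ (u + v) / y ^ (u - v)) := by
        generalize (-1 : ℂ) ^ (u + v) = b1
        generalize (-1 : ℂ) ^ (u - v) = b2
        generalize r ^ ((u + v) * (u + v) - (u + v)) = b3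
        generalize r ^ ((u - v) * (u - v) - (u - v)) = b4
        generalize x ^ (u + v) = b5
        generalize x ^ (u - v) = b6
        generalize y ^ (u + v) = b7
        generalize y ^ (u - v) = b8
        ring
    _ = _ := by
        rw [a1, a2, a3, a4]
        simp only [one_mul, mul_comm, mul_left_comm, mul_assoc]

lemma term_odd {r x y : ℂ} (hr0 : r ≠ 0) (hx : x ≠ 0) (hy : y ≠ 0) (u v : ℤ) :
    st r (x * y) (u + v) * st r (x / y) (u - v + 1) =
      -(x / y) * ((r ^ (2 * (u * u)) * x ^ (2 * u)) * (r ^ (2 * (v * v - v)) * y ^ (2 * v))) := by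
  have hm1 : (-1 : ℂ) ≠ 0 := by norm_num
  unfold st
  rw [div_zpow, mul_zpow]
  have a1 : (-1 : ℂ) ^ (u + v) * (-1) ^ (u - v + 1) = -1 := by
    rw [← zpow_add₀ hm1, show u + v + (u - v + 1) = 2 * u + 1 by ring, zpow_add₀ hm1, zpow_mul]
    norm_num
  have a2 : r ^ ((u + v) * (u + v) - (u + v)) * r ^ ((u - v + 1) * (u - v + 1) - (u - v + 1))
      = r ^ (2 * (u * u)) * r ^ (2 * (v * v - v)) := by
    rw [← zpow_add₀ hr0, ← zpow_add₀ hr0]; congr 1; ring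
  have a3 : x ^ (u + v) * x ^ (u - v + 1) = x ^ (2 * u) * x := by
    rw [← zpow_add₀ hx, ← zpow_add_one₀ hx]; congr 1; ring
  have a4 : y ^ (u + v) / y ^ (u - v + 1) = y ^ (2 * v) / y := by
    rw [← zpow_sub₀ hy, div_eq_mul_inv, ← zpow_sub_one₀ hy]; congr 1; ring
  calc _ = ((-1 : ℂ) ^ (u + v) * (-1) ^ (u - v + 1)) *
        (r ^ ((u + v) * (u + v) - (u + v)) * r ^ ((u - v + 1) * (u - v + 1) - (u - v + 1))) *
        (x ^ (u + v) * x ^ (u - v + 1)) * (y ^ (u + v) / y ^ (u - v + 1)) := by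
        generalize (-1 : ℂ) ^ (u + v) = b1
        generalize (-1 : ℂ) ^ (u - v + 1) = b2
        generalize r ^ ((u + v) * (u + v) - (u + v)) = b3
        generalize r ^ ((u - v + 1) * (u - v + 1) - (u - v + 1)) = b4
        generalize x ^ (u + v) = b5
        generalize x ^ (u - v + 1) = b6
        generalize y ^ (u + v) = b7
        generalize y ^ (u - v + 1) = b8
        ring
    _ = _ := by
        rw [a1, a2, a3, a4]
        generalize r ^ (2 * (u * u)) = b3
        generalize r ^ (2 * (v * v - v)) = b4
        generalize x ^ (2 * u) = b5
        generalize y ^ (2 * v) = b6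
        ring

lemma hasSum_mul_gen (f g : ℤ → ℂ) (hf : Summable f) (hg : Summable g) :
    HasSum (fun u : ℤ × ℤ => f u.1 * g u.2) ((∑' n, f n) * ∑' n, g n) :=
  hf.hasSum.mul hg.hasSum (summable_mul_of_summable_norm hf.norm hg.norm)

lemma hasSum_par (F : ℤ × ℤ → ℂ) (A B C : ℂ) (hF : HasSum F C)
    (h1 : HasSum (fun u : ℤ × ℤ => F (u.1 + u.2, u.1 - u.2)) A)
    (h2 : HasSum (fun u : ℤ × ℤ => F (u.1 + u.2, u.1 - u.2 + 1)) B) : C = A + B := by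
  have h3 := (par.hasSum_iff).mpr hF
  have h4 : HasSum (F ∘ par) (A + B) := HasSum.sum h1 h2
  exact h3.unique h4

lemma S_mul {r x y : ℂ} (hr0 : r ≠ 0) (hr : ‖r‖ < 1) (hx : x ≠ 0) (hy : y ≠ 0) :
    S r (x * y) * S r (x / y) = E r x * G r y - x / y * (G r x * E r y) := by
  have hprod := hasSum_mul_gen _ _ (summable_st hr0 hr (mul_ne_zero hx hy))
    (summable_st hr0 hr (div_ne_zero hx hy))
  have k1 := hasSum_mul_gen _ _ (summable_E hr0 hr hx) (summable_G hr0 hr hy)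
  have k2 := (hasSum_mul_gen _ _ (summable_G hr0 hr hx) (summable_E hr0 hr hy)).mul_left (-(x / y))
  rw [← S, ← S] at hprod
  rw [← E, ← G] at k1
  rw [← E, ← G] at k2
  simp only [← term_even hr0 hx hy] at k1
  simp only [← term_odd hr0 hx hy] at k2
  have := hasSum_par (fun m : ℤ × ℤ => st r (x * y) m.1 * st r (x / y) m.2) _ _ _ hprod k1 k2
  rw [this, neg_mul, sub_eq_add_neg]

lemma weier {r a b c : ℂ} (hr0 : r ≠ 0) (hr : ‖r‖ < 1) (ha : a ≠ 0) (hb : b ≠ 0) (hc : c ≠ 0) :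
    S r (a * b) * S r (a / b) * S r c ^ 2 - S r a ^ 2 * (S r (c * b) * S r (c / b)) =
      c / b * (S r b ^ 2 * (S r (a * c) * S r (a / c))) := by
  have k (x : ℂ) (hx : x ≠ 0) : S r x ^ 2 = E r x * G r 1 - x * (G r x * E r 1) := by
    have := S_mul hr0 hr hx one_ne_zero
    rw [mul_one, div_one] at this
    rw [← this]; ring
  rw [k a ha, k b hb, k c hc, S_mul hr0 hr ha hb, S_mul hr0 hr hc hb, S_mul hr0 hr ha hc]
  field_simp
  ring

/-- `θ_k` -/
noncomputable def T (q : ℂ) (k l : ℕ) : ℂ := qPoch (q ^ k) (q ^ 10) * qPoch (q ^ l) (q ^ 10)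

lemma S_T {q : ℂ} (hq0 : q ≠ 0) (hq : ‖q‖ < 1) (k l : ℕ) (h : k + l = 10) :
    S (q ^ 5) (q ^ k) = T q k l * qPoch (q ^ 10) (q ^ 10) := by
  have hr : ‖q ^ 5‖ < 1 := by
    rw [norm_pow]; exact pow_lt_one₀ (norm_nonneg _) hq (by norm_num)
  have hp : ‖q ^ 10‖ < 1 := by
    rw [norm_pow]; exact pow_lt_one₀ (norm_nonneg _) hq (by norm_num)
  have := triple (r := q ^ 5) (z := q ^ k) (pow_ne_zero _ hq0) hr (pow_ne_zero _ hq0)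
  have e : (q ^ 5) ^ 2 = q ^ 10 := by ring
  rw [e] at this
  have e2 : q ^ 10 / q ^ k = q ^ l := by
    rw [← h, pow_add, mul_div_cancel_left₀ _ (pow_ne_zero _ hq0)]
  rw [e2] at this
  have hC := qPoch_ne hp hp
  rw [T, this, inv_mul_cancel_right₀ hC]

lemma rels {q : ℂ} (hq0 : q ≠ 0) (hq : ‖q‖ < 1) :
    T q 5 5 * T q 3 7 * T q 2 8 ^ 2 - T q 4 6 ^ 2 * (T q 3 7 * T q 1 9)
      = q * (T q 1 9 ^ 2 * (T q 4 6 * T q 2 8)) ∧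
    T q 5 5 * T q 3 7 * T q 3 7 ^ 2 - T q 4 6 ^ 2 * (T q 4 6 * T q 2 8)
      = q ^ 2 * (T q 1 9 ^ 2 * (T q 3 7 * T q 1 9)) := by
  have hr : ‖q ^ 5‖ < 1 := by
    rw [norm_pow]; exact pow_lt_one₀ (norm_nonneg _) hq (by norm_num)
  have hp : ‖q ^ 10‖ < 1 := by
    rw [norm_pow]; exact pow_lt_one₀ (norm_nonneg _) hq (by norm_num)
  have hC := qPoch_ne hp hp
  have hd (i j k : ℕ) (h : j + k = i) : q ^ i / q ^ j = q ^ k := by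
    rw [← h, pow_add, mul_div_cancel_left₀ _ (pow_ne_zero _ hq0)]
  have hn (k : ℕ) : q ^ k ≠ 0 := pow_ne_zero _ hq0
  have wA := weier (r := q ^ 5) (hn 5) hr (hn 4) (hn 1) (hn 2)
  have wB := weier (r := q ^ 5) (hn 5) hr (hn 4) (hn 1) (hn 3)
  rw [hd 4 1 3 rfl, hd 2 1 1 rfl, hd 4 2 2 rfl, ← pow_add, ← pow_add, ← pow_add] at wA
  rw [hd 4 1 3 rfl, hd 3 1 2 rfl, hd 4 3 1 rfl, ← pow_add, ← pow_add, ← pow_add] at wB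
  norm_num only at wA wB
  rw [S_T hq0 hq 5 5 rfl, S_T hq0 hq 3 7 rfl, S_T hq0 hq 4 6 rfl, S_T hq0 hq 2 8 rfl,
    S_T hq0 hq 1 9 rfl, S_T hq0 hq 6 4 rfl] at wA
  rw [S_T hq0 hq 5 5 rfl, S_T hq0 hq 3 7 rfl, S_T hq0 hq 4 6 rfl, S_T hq0 hq 2 8 rfl,
    S_T hq0 hq 1 9 rfl, S_T hq0 hq 7 3 rfl] at wB
  have c6 : T q 6 4 = T q 4 6 := mul_comm _ _
  have c7 : T q 7 3 = T q 3 7 := mul_comm _ _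
  rw [c6] at wA
  rw [c7] at wB
  constructor
  · apply mul_right_cancel₀ (pow_ne_zero 4 hC)
    linear_combination wA
  · apply mul_right_cancel₀ (pow_ne_zero 4 hC)
    linear_combination wB

end ThetaAux

open ThetaAux
/-- For every `τ ∈ ℍ`, `I(τ)·(1 + I(τ)J(τ)) = J(τ)²·(I(τ)³ + J(τ))`. -/
theorem statement10 (τ : UpperHalfPlane) :
    Ifun τ * (1 + Ifun τ * Jfun τ) = Jfun τ ^ 2 * (Ifun τ ^ 3 + Jfun τ) := by
  have hq0 : Qc τ ≠ 0 := Complex.exp_ne_zero _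
  have hq : ‖Qc τ‖ < 1 := by
    have := UpperHalfPlane.norm_exp_two_pi_I_lt_one τ
    simpa [Qc] using this
  obtain ⟨x, hx⟩ : ∃ x, x = Complex.exp (2 * Real.pi * Complex.I * τ * (1 / 4)) := ⟨_, rfl⟩
  have hx3 : Complex.exp (2 * Real.pi * Complex.I * τ * (3 / 4)) = x ^ 3 := by
    rw [hx, ← Complex.exp_nat_mul]; congr 1; push_cast; ring
  have hx4 : Qc τ = x ^ 4 := by
    rw [hx, ← Complex.exp_nat_mul, Qc]; congr 1; push_cast; ring
  obtain ⟨rA, rB⟩ := rels hq0 hq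
  have hk (k : ℕ) (h : k ≠ 0) : ‖Qc τ ^ k‖ < 1 := by
    rw [norm_pow]; exact pow_lt_one₀ (norm_nonneg _) hq h
  have h3 : T (Qc τ) 3 7 ≠ 0 := mul_ne_zero (qPoch_ne (hk 3 (by norm_num)) (hk 10 (by norm_num)))
    (qPoch_ne (hk 7 (by norm_num)) (hk 10 (by norm_num)))
  have h4 : T (Qc τ) 4 6 ≠ 0 := mul_ne_zero (qPoch_ne (hk 4 (by norm_num)) (hk 10 (by norm_num)))
    (qPoch_ne (hk 6 (by norm_num)) (hk 10 (by norm_num)))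
  have hI : Ifun τ = x ^ 3 * T (Qc τ) 1 9 / T (Qc τ) 4 6 := by
    rw [Ifun, hx3, T, T, pow_one]
  have hJ : Jfun τ = x * T (Qc τ) 2 8 / T (Qc τ) 3 7 := by
    rw [Jfun, ← hx, T, T]
  rw [hI, hJ]
  generalize T (Qc τ) 1 9 = t1 at *
  generalize T (Qc τ) 2 8 = t2 at *
  generalize T (Qc τ) 3 7 = t3 at *
  generalize T (Qc τ) 4 6 = t4 at *
  generalize T (Qc τ) 5 5 = t5 at *
  rw [hx4] at rA rB
  have key : t1 * t3 ^ 3 * t4 ^ 2 + x ^ 4 * t1 ^ 2 * t2 * t3 ^ 2 * t4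
      = x ^ 8 * t1 ^ 3 * t2 ^ 2 * t3 + t2 ^ 3 * t4 ^ 3 := by
    linear_combination (-t3 ^ 2) * rA + t2 ^ 2 * rB
  have : x ^ 3 * t1 / t4 * (1 + x ^ 3 * t1 / t4 * (x * t2 / t3)) -
      (x * t2 / t3) ^ 2 * ((x ^ 3 * t1 / t4) ^ 3 + x * t2 / t3) =
      x ^ 3 / (t3 ^ 3 * t4 ^ 3) * ((t1 * t3 ^ 3 * t4 ^ 2 + x ^ 4 * t1 ^ 2 * t2 * t3 ^ 2 * t4) -
        (x ^ 8 * t1 ^ 3 * t2 ^ 2 * t3 + t2 ^ 3 * t4 ^ 3)) := by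
    field_simp
  rw [key, sub_self, mul_zero] at this
  exact sub_eq_zero.mp this
end

section
/- (Modular equation of level five for U.) For every τ ∈ ℍ, one has U(τ)⁵ − U(5τ) = 5U(τ)U(5τ)·R(U(τ), U(5τ)), where R(X,Y) = (5Y⁴ − 5Y² + 1)X³ − Y(5Y² − 3)X² + (3Y² − 1)X − Y. -/
open Complex

/-- `U(τ) = q^{1/2}·(q;q)∞(q¹⁰;q¹⁰)∞² / ((q²;q²)∞²(q⁵;q⁵)∞)` with `q^{1/2} = e^{πiτ}`;
this is the η-quotient `η(τ)η(10τ)²/(η(2τ)²η(5τ))`. -/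
noncomputable def Ufun (τ : UpperHalfPlane) : ℂ :=
  Complex.exp (Real.pi * Complex.I * τ) *
    (qPoch (Qc τ) (Qc τ) * qPoch (Qc τ ^ 10) (Qc τ ^ 10) ^ 2) /
    (qPoch (Qc τ ^ 2) (Qc τ ^ 2) ^ 2 * qPoch (Qc τ ^ 5) (Qc τ ^ 5))


/-- The point `5τ` of the upper half-plane. -/
noncomputable def mul5 (τ : UpperHalfPlane) : UpperHalfPlane := ⟨5 * (τ : ℂ), by simpa using τ.2⟩

/-- `R(X,Y) = (5Y⁴ − 5Y² + 1)X³ − Y(5Y² − 3)X² + (3Y² − 1)X − Y`. -/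
noncomputable def Rpoly (X Y : ℂ) : ℂ :=
  (5 * Y ^ 4 - 5 * Y ^ 2 + 1) * X ^ 3 - Y * (5 * Y ^ 2 - 3) * X ^ 2 + (3 * Y ^ 2 - 1) * X - Y

namespace S16
open Filter Topology

lemma hasProd_e {q : ℂ} (hq : ‖q‖ < 1) :
    HasProd (fun n : ℕ => 1 - q ^ (n + 1)) (qPoch q q) := by
  have h := (ModularForm.multipliable_one_sub_pow hq).hasProd
  have : qPoch q q = ∏' n : ℕ, (1 - q ^ (n + 1)) := by
    unfold qPoch
    congr 1; ext n; ring
  rw [this]; exact h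

lemma one_sub_ne {q : ℂ} (hq : ‖q‖ < 1) (n : ℕ) (hn : n ≠ 0) : 1 - q ^ n ≠ 0 := by
  intro h
  have h1 : q ^ n = 1 := (sub_eq_zero.mp h).symm
  have h2 : ‖q‖ ^ n = 1 := by rw [← norm_pow, h1, norm_one]
  have h3 := pow_lt_one₀ (norm_nonneg q) hq hn
  linarith

lemma e_ne_zero {q : ℂ} (hq : ‖q‖ < 1) : qPoch q q ≠ 0 := by
  rw [← (hasProd_e hq).tprod_eq]
  have := tprod_one_add_ne_zero_of_summable (f := fun n : ℕ => -q ^ (n + 1)) ?_ ?_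
  · simpa [sub_eq_add_neg] using this
  · intro n
    have := one_sub_ne hq (n+1) (by omega)
    simpa [sub_eq_add_neg] using this
  · simpa using (summable_nat_add_iff 1).mpr (summable_geometric_of_lt_one (norm_nonneg _) hq)

/-- Partial products. -/
noncomputable def PP (q : ℂ) (n : ℕ) : ℂ :=
  ∏ r ∈ Finset.range n, ((1 - q ^ (2 * r + 2)) / (1 - q ^ (2 * r + 1)))

lemma PP_ne {q : ℂ} (hq : ‖q‖ < 1) (n : ℕ) : PP q n ≠ 0 := by
  unfold PP
  rw [Finset.prod_ne_zero_iff]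
  intro r _
  exact div_ne_zero (one_sub_ne hq _ (by omega)) (one_sub_ne hq _ (by omega))

lemma PP_succ (q : ℂ) (n : ℕ) :
    PP q (n + 1) = PP q n * ((1 - q ^ (2 * n + 2)) / (1 - q ^ (2 * n + 1))) := by
  unfold PP; rw [Finset.prod_range_succ]

lemma PP_eq {q : ℂ} (hq : ‖q‖ < 1) (n : ℕ) :
    PP q n * ∏ r ∈ Finset.range (2 * n), (1 - q ^ (r + 1)) =
      (∏ r ∈ Finset.range n, (1 - (q ^ 2) ^ (r + 1))) ^ 2 := by
  induction n with
  | zero => simp [PP]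
  | succ n ih =>
    rw [PP_succ, Finset.prod_range_succ, show 2 * (n + 1) = 2 * n + 1 + 1 by ring,
      Finset.prod_range_succ, Finset.prod_range_succ, mul_pow, ← ih]
    have := one_sub_ne hq (2 * n + 1) (by omega)
    field_simp
    ring

lemma PP_tendsto {q : ℂ} (hq : ‖q‖ < 1) :
    Tendsto (PP q) atTop (𝓝 (qPoch (q ^ 2) (q ^ 2) ^ 2 / qPoch q q)) := by
  have hq2 : ‖q ^ 2‖ < 1 := by
    rw [norm_pow]; exact pow_lt_one₀ (norm_nonneg q) hq (by norm_num)
  have h1 := (hasProd_e hq).tendsto_prod_nat.comp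
    (tendsto_id.const_mul_atTop' (show 0 < 2 by norm_num) : Tendsto (fun n : ℕ => 2 * n) atTop atTop)
  have h2 := ((hasProd_e hq2).tendsto_prod_nat).pow 2
  refine (h2.div h1 (e_ne_zero hq)).congr fun n => ?_
  have : ∏ r ∈ Finset.range (2 * n), (1 - q ^ (r + 1)) ≠ 0 := by
    rw [Finset.prod_ne_zero_iff]
    intro r _
    exact one_sub_ne hq _ (by omega)
  simp only [Function.comp, Pi.div_apply]
  rw [← PP_eq hq]
  field_simp

lemma shanks {q : ℂ} (hq : ‖q‖ < 1) (n : ℕ) :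
    ∑ k ∈ Finset.range n, (q ^ (k * (2 * k + 1)) + q ^ ((2 * k + 1) * (k + 1))) =
      ∑ s ∈ Finset.range n, PP q n / PP q s * q ^ (s * (2 * n + 1)) := by
  induction n with
  | zero => simp
  | succ n ih =>
    have hD := one_sub_ne hq (2 * n + 1) (by omega)
    have hPn := PP_ne hq n
    have tel : ∀ s, PP q (n + 1) / PP q s * q ^ (s * (2 * (n + 1) + 1)) -
        PP q n / PP q s * q ^ (s * (2 * n + 1)) =
        (PP q n / PP q (s + 1) * (1 - q ^ (2 * (s + 1))) * q ^ ((s + 1) * (2 * n + 1)) -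
        PP q n / PP q s * (1 - q ^ (2 * s)) * q ^ (s * (2 * n + 1))) / (1 - q ^ (2 * n + 1)) := by
      intro s
      have h1 := PP_ne hq s
      have h2 := one_sub_ne hq (2 * s + 1) (by omega)
      have h3 := one_sub_ne hq (2 * s + 2) (by omega)
      rw [PP_succ, PP_succ]
      rw [show 2 * (s + 1) = 2 * s + 2 by ring]
      field_simp
      ring
    have key := Finset.sum_congr (rfl : Finset.range n = Finset.range n) fun s _ => tel s
    rw [Finset.sum_sub_distrib, ← Finset.sum_div, Finset.sum_range_sub (fun s =>
      PP q n / PP q s * (1 - q ^ (2 * s)) * q ^ (s * (2 * n + 1)))] at key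
    rw [Finset.sum_range_succ, ih, Finset.sum_range_succ, eq_add_of_sub_eq key, PP_succ]
    simp only [div_self hPn, mul_zero, pow_zero, sub_self, zero_mul, sub_zero, one_mul]
    field_simp
    ring

lemma gauss_tendsto {q : ℂ} (hq : ‖q‖ < 1) :
    Tendsto (fun n => ∑ k ∈ Finset.range n, (q ^ (k * (2 * k + 1)) + q ^ ((2 * k + 1) * (k + 1))))
      atTop (𝓝 (qPoch (q ^ 2) (q ^ 2) ^ 2 / qPoch q q)) := by
  have hq2 : ‖q ^ 2‖ < 1 := by
    rw [norm_pow]; exact pow_lt_one₀ (norm_nonneg q) hq (by norm_num)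
  have hP := PP_tendsto hq
  have hne : qPoch (q ^ 2) (q ^ 2) ^ 2 / qPoch q q ≠ 0 :=
    div_ne_zero (pow_ne_zero _ (e_ne_zero hq2)) (e_ne_zero hq)
  obtain ⟨K1, hK1⟩ := (Metric.isBounded_range_of_tendsto _ hP).exists_norm_le
  obtain ⟨K2, hK2⟩ := (Metric.isBounded_range_of_tendsto _ (hP.inv₀ hne)).exists_norm_le
  have hK1' : ∀ n, ‖PP q n‖ ≤ K1 := fun n => hK1 _ ⟨n, rfl⟩
  have hK2' : ∀ n, ‖(PP q n)⁻¹‖ ≤ K2 := fun n => hK2 _ ⟨n, rfl⟩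
  have hK1n : 0 ≤ K1 := (norm_nonneg _).trans (hK1' 0)
  have hK2n : 0 ≤ K2 := (norm_nonneg _).trans (hK2' 0)
  rw [← tendsto_add_atTop_iff_nat 1]
  have hP1 := (tendsto_add_atTop_iff_nat 1).mpr hP
  have hsmall : Tendsto (fun n => ∑ s ∈ Finset.range n,
      PP q (n + 1) / PP q (s + 1) * q ^ ((s + 1) * (2 * (n + 1) + 1))) atTop (𝓝 0) := by
    have hb : Tendsto (fun n : ℕ => K1 * K2 * (1 - ‖q‖)⁻¹ * ‖q‖ ^ n) atTop (𝓝 0) := by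
      simpa using (tendsto_pow_atTop_nhds_zero_of_lt_one (norm_nonneg q) hq).const_mul
        (K1 * K2 * (1 - ‖q‖)⁻¹)
    refine squeeze_zero_norm (fun n => ?_) hb
    calc _ ≤ ∑ s ∈ Finset.range n, K1 * K2 * ‖q‖ ^ n * ‖q‖ ^ s := by
          refine norm_sum_le_of_le _ fun s _ => ?_
          rw [div_eq_mul_inv, norm_mul, norm_mul, norm_pow, mul_assoc (K1 * K2), ← pow_add]
          refine mul_le_mul (mul_le_mul (hK1' _) (hK2' _) (norm_nonneg _) hK1n) ?_
            (by positivity) (by positivity)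
          exact pow_le_pow_of_le_one (norm_nonneg q) hq.le (by nlinarith [Nat.zero_le (s * n)])
      _ = K1 * K2 * ‖q‖ ^ n * ∑ s ∈ Finset.range n, ‖q‖ ^ s := by rw [Finset.mul_sum]
      _ ≤ K1 * K2 * ‖q‖ ^ n * (1 - ‖q‖)⁻¹ := by
          refine mul_le_mul_of_nonneg_left ?_ (by positivity)
          rw [← tsum_geometric_of_lt_one (norm_nonneg q) hq]
          exact (summable_geometric_of_lt_one (norm_nonneg q) hq).sum_le_tsum _
            (fun _ _ => by positivity)
      _ = _ := by ring
  have := hsmall.add hP1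
  rw [zero_add] at this
  refine this.congr fun n => ?_
  rw [shanks hq, Finset.sum_range_succ']
  simp [PP]

/-- product over fifth roots of unity -/
lemma prod_roots {w : ℂ} (hw : IsPrimitiveRoot w 5) (x : ℂ) :
    ∏ k ∈ Finset.range 5, (1 - w ^ k * x) = 1 - x ^ 5 := by
  have h1 := hw.geom_sum_eq_zero (by norm_num)
  have h5 := hw.pow_eq_one
  simp only [Finset.sum_range_succ, Finset.prod_range_succ, Finset.sum_range_zero,
    Finset.prod_range_zero] at *
  have e4 : w ^ 4 = -1 - w - w ^ 2 - w ^ 3 := by linear_combination h1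
  have : IsPrimitiveRoot w 5 := hw
  grind

lemma pow_prim {w : ℂ} (hw : IsPrimitiveRoot w 5) (n : ℕ) (hn : ¬ 5 ∣ n) :
    IsPrimitiveRoot (w ^ n) 5 :=
  hw.pow_of_coprime n (((Nat.prime_five).coprime_iff_not_dvd.mpr hn).symm)

lemma prod_e {w : ℂ} (hw : IsPrimitiveRoot w 5) {q : ℂ} (hq : ‖q‖ < 1) :
    (∏ k ∈ Finset.range 5, qPoch (w ^ k * q) (w ^ k * q)) * qPoch (q ^ 25) (q ^ 25) =
      qPoch (q ^ 5) (q ^ 5) ^ 6 := by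
  have nn : ∀ n : ℕ, n ≠ 0 → ‖q ^ n‖ < 1 := fun n hn => by
    rw [norm_pow]; exact pow_lt_one₀ (norm_nonneg q) hq hn
  have hw1 : ‖w‖ = 1 := hw.norm'_eq_one (by norm_num)
  have hinj : Function.Injective (fun m : ℕ => 5 * m + 4) := fun a b h => by
    simp only at h; omega
  have hA : HasProd (fun n : ℕ => ∏ k ∈ Finset.range 5, (1 - (w ^ k * q) ^ (n + 1)))
      (∏ k ∈ Finset.range 5, qPoch (w ^ k * q) (w ^ k * q)) := by
    apply hasProd_prod
    intro k _
    apply hasProd_e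
    rw [norm_mul, norm_pow, hw1]; simpa using hq
  have ext : ∀ (g : ℕ → ℂ) (a : ℂ), HasProd (fun m => g (5 * m + 4)) a →
      HasProd (fun n => if 5 ∣ n + 1 then g n else 1) a := by
    intro g a h
    rw [← hinj.hasProd_iff]
    · convert h using 2 with m
      simp only [Function.comp]
      rw [if_pos (by omega)]
    · intro x hx
      rw [if_neg]
      rintro ⟨m, hm⟩
      exact hx ⟨m - 1, by simp only; omega⟩
  have hB := ext (fun n => 1 - q ^ (5 * (n + 1))) (qPoch (q ^ 25) (q ^ 25)) (by
    convert hasProd_e (nn 25 (by norm_num)) using 2 with m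
    rw [← pow_mul]; congr 2; ring)
  have hC : HasProd (fun n => 1 - q ^ (5 * (n + 1))) (qPoch (q ^ 5) (q ^ 5)) := by
    convert hasProd_e (nn 5 (by norm_num)) using 2 with m
    rw [← pow_mul]
  have hD := ext (fun n => (1 - q ^ (n + 1)) ^ 5) (qPoch (q ^ 5) (q ^ 5) ^ 5) (by
    convert (hasProd_e (nn 5 (by norm_num))).pow 5 using 2 with m
    rw [← pow_mul]; congr 2)
  have h1 := hA.mul hB
  have h2 := hC.mul hD
  rw [show qPoch (q ^ 5) (q ^ 5) ^ 6 = qPoch (q ^ 5) (q ^ 5) * qPoch (q ^ 5) (q ^ 5) ^ 5 by ring]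
  refine h1.unique ?_
  convert h2 using 2 with n
  by_cases hn : 5 ∣ n + 1
  · rw [if_pos hn, if_pos hn]
    have : ∀ k, (w ^ k * q) ^ (n + 1) = q ^ (n + 1) := by
      intro k
      obtain ⟨m, hm⟩ := hn
      rw [mul_pow, hm, ← pow_mul, show k * (5 * m) = 5 * (k * m) by ring, pow_mul,
        hw.pow_eq_one, one_pow, one_mul]
    simp only [this, Finset.prod_const, Finset.card_range]
    ring
  · rw [if_neg hn, if_neg hn, mul_one, mul_one]
    have := prod_roots (pow_prim hw (n + 1) hn) (q ^ (n + 1))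
    rw [← pow_mul, mul_comm (n + 1) 5] at this
    rw [← this]
    refine Finset.prod_congr rfl fun k _ => ?_
    rw [mul_pow, ← pow_mul, ← pow_mul, mul_comm k]

/-- theta series -/
noncomputable def Th (p : ℂ) : ℂ := ∑' n : ℤ, p ^ ((2 * n + 1) ^ 2)

/-- theta series over a residue class mod 10 -/
noncomputable def cc (p : ℂ) (i : ℤ) : ℂ := ∑' m : ℤ, p ^ ((10 * m + i) ^ 2)

lemma summable_sq {p : ℂ} (hp0 : p ≠ 0) (hp : ‖p‖ < 1) :
    Summable (fun n : ℤ => ‖p ^ (n ^ 2)‖) := by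
  have hN : Summable (fun n : ℕ => ‖p‖ ^ (n ^ 2)) := by
    refine Summable.of_nonneg_of_le (fun n => by positivity) (fun n => ?_)
      (summable_geometric_of_lt_one (norm_nonneg p) hp)
    exact pow_le_pow_of_le_one (norm_nonneg p) hp.le (by nlinarith [sq_nonneg (n : ℤ), Nat.le_self_pow two_ne_zero n])
  refine Summable.of_nat_of_neg ?_ ?_
  · refine hN.congr fun n => ?_
    rw [norm_zpow]; symm; exact_mod_cast zpow_natCast ‖p‖ (n ^ 2)
  · refine hN.congr fun n => ?_
    rw [norm_zpow, neg_sq]; symm; exact_mod_cast zpow_natCast ‖p‖ (n ^ 2)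

lemma summable_lin {p : ℂ} (hp0 : p ≠ 0) (hp : ‖p‖ < 1) (a b : ℤ) (ha : a ≠ 0) :
    Summable (fun n : ℤ => ‖p ^ ((a * n + b) ^ 2)‖) :=
  (summable_sq hp0 hp).comp_injective (i := fun n : ℤ => a * n + b) (fun x y h => by
    simp only at h
    exact mul_left_cancel₀ ha (by linarith))

lemma Th_gauss {p : ℂ} (hp0 : p ≠ 0) (hp : ‖p‖ < 1) :
    Th p * qPoch (p ^ 8) (p ^ 8) = 2 * p * qPoch (p ^ 16) (p ^ 16) ^ 2 := by
  have hq : ‖p ^ 8‖ < 1 := by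
    rw [norm_pow]; exact pow_lt_one₀ (norm_nonneg p) hp (by norm_num)
  have hs := (summable_lin hp0 hp 2 1 (by norm_num)).of_norm
  have hsN : Summable (fun n : ℕ => p ^ ((2 * n + 1) ^ 2)) := by
    have := hs.comp_injective (i := fun n : ℕ => (n : ℤ)) Nat.cast_injective
    refine this.congr fun n => ?_
    simp only [Function.comp]
    exact_mod_cast (zpow_natCast p ((2 * n + 1) ^ 2))
  have hT : Th p = 2 * ∑' n : ℕ, p ^ ((2 * n + 1) ^ 2) := by
    rw [two_mul]
    refine HasSum.tsum_eq (HasSum.of_nat_of_neg_add_one ?_ ?_)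
    · convert hsN.hasSum using 2 with n
      exact_mod_cast (zpow_natCast p ((2 * n + 1) ^ 2))
    · convert hsN.hasSum using 2 with n
      rw [show (2 * (-((n : ℤ) + 1)) + 1) ^ 2 = (2 * n + 1) ^ 2 by ring]
      exact_mod_cast (zpow_natCast p ((2 * n + 1) ^ 2))
  have h1 := hsN.hasSum.tendsto_sum_nat.comp
    (tendsto_id.const_mul_atTop' (show 0 < 2 by norm_num) : Tendsto (fun n : ℕ => 2 * n) atTop atTop)
  have h2 := (gauss_tendsto hq).const_mul p
  have h3 := tendsto_nhds_unique h1 (h2.congr fun n => by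
    simp only [Function.comp]
    induction n with
    | zero => simp
    | succ n ih =>
      rw [Finset.sum_range_succ, mul_add, ih, show 2 * (n + 1) = 2 * n + 1 + 1 by ring,
        Finset.sum_range_succ, Finset.sum_range_succ, add_assoc, mul_add]
      congr 1
      rw [← pow_mul, ← pow_mul, ← pow_succ', ← pow_succ']
      congr 2 <;> push_cast <;> ring)
  rw [hT, h3, ← pow_mul]
  have := e_ne_zero hq
  field_simp

lemma Th_ne {p : ℂ} (hp0 : p ≠ 0) (hp : ‖p‖ < 1) : Th p ≠ 0 := by
  intro h
  have h1 := Th_gauss hp0 hp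
  have hq : ‖p ^ 16‖ < 1 := by
    rw [norm_pow]; exact pow_lt_one₀ (norm_nonneg p) hp (by norm_num)
  rw [h, zero_mul] at h1
  have := e_ne_zero hq
  have : (2 * p * qPoch (p ^ 16) (p ^ 16) ^ 2 : ℂ) ≠ 0 :=
    mul_ne_zero (mul_ne_zero two_ne_zero hp0) (pow_ne_zero _ this)
  exact this h1.symm

lemma cc_refl (p : ℂ) (i j : ℤ) (h : i + j = 10) : cc p i = cc p j := by
  unfold cc
  rw [← (Equiv.subLeft (-1 : ℤ)).tsum_eq]
  refine tsum_congr fun m => ?_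
  congr 1
  simp only [Equiv.subLeft_apply]
  obtain rfl : i = 10 - j := by linarith
  ring

lemma cc_five (p : ℂ) : cc p 5 = Th (p ^ 25) := by
  unfold cc Th
  refine tsum_congr fun m => ?_
  rw [← zpow_natCast, ← zpow_mul]
  congr 1
  push_cast
  ring

lemma tsum_fin5 {β γ : Type*} (e : Fin 5 × β ≃ γ) (f : γ → ℂ) (hf : Summable f) :
    ∑' x, f x = ∑ i : Fin 5, ∑' b, f (e (i, b)) := by
  rw [← e.tsum_eq, Summable.tsum_prod (f := fun c => f (e c)) ((e.summable_iff).mpr hf), tsum_fintype]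

lemma bij1 : Function.Bijective (fun x : Fin 5 × ℤ => 5 * x.2 + (x.1 : ℤ)) := by
  constructor
  · rintro ⟨i, m⟩ ⟨j, n⟩ h
    simp only at h
    have h1 : m = n := by omega
    have h2 : i = j := by ext; omega
    rw [h1, h2]
  · intro y
    refine ⟨(⟨(y % 5).toNat, by omega⟩, y / 5), ?_⟩
    simp only
    omega

lemma Th_split {p : ℂ} (hp0 : p ≠ 0) (hp : ‖p‖ < 1) :
    Th p = 2 * cc p 1 + 2 * cc p 3 + Th (p ^ 25) := by
  have hs := (summable_lin hp0 hp 2 1 (by norm_num)).of_norm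
  have h := tsum_fin5 (Equiv.ofBijective _ bij1) _ hs
  have : ∀ i : Fin 5, ∑' b : ℤ, p ^ ((2 * (Equiv.ofBijective _ bij1 (i, b)) + 1) ^ 2) =
      cc p (2 * (i : ℤ) + 1) := by
    intro i
    unfold cc
    refine tsum_congr fun m => ?_
    congr 1
    simp only [Equiv.ofBijective_apply]
    ring
  simp only [this] at h
  unfold Th at *
  rw [h, ← Th, ← cc_five]
  simp [Fin.sum_univ_five]
  norm_num
  rw [cc_refl p 7 3 (by norm_num), cc_refl p 9 1 (by norm_num)]
  ring

/-- offsets -/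
def ox : Fin 5 → ℤ := ![0, 1, 2, 1, 1]
/-- offsets -/
def oy : Fin 5 → ℤ := ![0, 0, 0, 1, -1]

lemma o_mod (i : Fin 5) : ox i + 2 * oy i = i ∨ (i = 4 ∧ ox i + 2 * oy i = -1) := by
  fin_cases i <;> simp [ox, oy]

lemma bij2 : Function.Bijective
    (fun x : Fin 5 × (ℤ × ℤ) => (2 * x.2.1 + x.2.2 + ox x.1, 2 * x.2.2 - x.2.1 + oy x.1)) := by
  constructor
  · rintro ⟨i, m, n⟩ ⟨j, m', n'⟩ h
    simp only [Prod.mk.injEq] at h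
    obtain ⟨ha, hb⟩ := h
    have h2 : i = j := by
      have h1 := o_mod i
      have h2 := o_mod j
      ext; omega
    subst h2
    have : m = m' := by omega
    have : n = n' := by omega
    simp_all
  · rintro ⟨x, y⟩
    let i : Fin 5 := ⟨((x + 2 * y) % 5).toNat, by omega⟩
    have hi : (i : ℤ) = (x + 2 * y) % 5 := by simp only [i]; omega
    have hm := o_mod i
    refine ⟨(i, (2 * (x - ox i) - (y - oy i)) / 5, ((x - ox i) + 2 * (y - oy i)) / 5), ?_⟩
    simp only [Prod.mk.injEq]
    omega

lemma sq_identity {p : ℂ} (hp0 : p ≠ 0) (hp : ‖p‖ < 1) :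
    Th (p ^ 5) ^ 2 = Th (p ^ 25) ^ 2 + 4 * (cc p 1 * cc p 3) := by
  have hq : ‖p ^ 5‖ < 1 := by
    rw [norm_pow]; exact pow_lt_one₀ (norm_nonneg p) hp (by norm_num)
  have hs := summable_lin (pow_ne_zero 5 hp0) hq 2 1 (by norm_num)
  have hsc := fun i => summable_lin hp0 hp 10 i (by norm_num)
  have h1 : Th (p ^ 5) ^ 2 = ∑' z : ℤ × ℤ, (p ^ 5) ^ ((2 * z.1 + 1) ^ 2) *
      (p ^ 5) ^ ((2 * z.2 + 1) ^ 2) := by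
    rw [sq, Th, tsum_mul_tsum_of_summable_norm hs hs]
  have h2 := tsum_fin5 (Equiv.ofBijective _ bij2) _ (summable_mul_of_summable_norm hs hs)
  have h3 : ∀ i : Fin 5, (∑' b : ℤ × ℤ,
      (p ^ 5) ^ ((2 * (Equiv.ofBijective _ bij2 (i, b)).1 + 1) ^ 2) *
      (p ^ 5) ^ ((2 * (Equiv.ofBijective _ bij2 (i, b)).2 + 1) ^ 2)) =
      cc p (4 * ox i - 2 * oy i + 1) * cc p (2 * ox i + 4 * oy i + 3) := by
    intro i
    unfold cc
    rw [tsum_mul_tsum_of_summable_norm (hsc _) (hsc _)]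
    refine tsum_congr fun b => ?_
    rw [← zpow_natCast, ← zpow_mul, ← zpow_mul, ← zpow_add₀ hp0, ← zpow_add₀ hp0]
    congr 1
    simp only [Equiv.ofBijective_apply]
    push_cast
    ring
  rw [h1, h2]
  simp only [h3]
  rw [← cc_five]
  simp [Fin.sum_univ_five, ox, oy]
  norm_num
  rw [cc_refl p 7 3 (by norm_num), cc_refl p 9 1 (by norm_num)]
  ring

lemma cc_root {w : ℂ} (hw : w ^ 5 = 1) (p : ℂ) (i : ℕ) (k : ℕ) :
    cc (w ^ k * p) i = w ^ (k * i ^ 2) * cc p i := by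
  have hw0 : w ≠ 0 := by rintro rfl; norm_num at hw
  unfold cc
  rw [← tsum_mul_left]
  refine tsum_congr fun m => ?_
  rw [mul_zpow]
  congr 1
  rw [← zpow_natCast, ← zpow_natCast, ← zpow_mul,
    show (k : ℤ) * (10 * m + i) ^ 2 = (k * i ^ 2 : ℕ) + (5 : ℕ) * (k * (20 * m ^ 2 + 4 * m * i)) by
      push_cast; ring,
    zpow_add₀ hw0, zpow_mul w ((5 : ℕ) : ℤ), zpow_natCast w 5, hw, one_zpow, mul_one]

lemma prod_lin {w : ℂ} (hw : IsPrimitiveRoot w 5) (s t c : ℂ) :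
    ∏ k ∈ Finset.range 5, (w ^ (k * 1 ^ 2) * s + w ^ (k * 3 ^ 2) * t + c) =
      c ^ 5 - 5 * s * t * c ^ 3 + 5 * s ^ 2 * t ^ 2 * c + s ^ 5 + t ^ 5 := by
  have h1 := hw.geom_sum_eq_zero (by norm_num)
  have h5 := hw.pow_eq_one
  have e : ∀ k, w ^ (k * 3 ^ 2) = (w ^ 4) ^ k := by
    intro k
    rw [← pow_mul, show k * 3 ^ 2 = 5 * k + 4 * k by ring, pow_add, pow_mul, h5, one_pow, one_mul]
  simp only [e]
  simp only [Finset.sum_range_succ, Finset.prod_range_succ, Finset.sum_range_zero,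
    Finset.prod_range_zero] at *
  have e4 : w ^ 4 = -1 - w - w ^ 2 - w ^ 3 := by linear_combination h1
  have e8 : (w ^ 4) ^ 2 = w ^ 3 := by linear_combination w ^ 3 * h5
  have e12 : (w ^ 4) ^ 3 = w ^ 2 := by linear_combination (w ^ 7 + w ^ 2) * h5
  have e16 : (w ^ 4) ^ 4 = w := by linear_combination (w ^ 11 + w ^ 6 + w) * h5
  rw [e8, e12, e16]
  norm_num
  grind

lemma prod_Th {p : ℂ} (hp0 : p ≠ 0) (hp : ‖p‖ < 1) :
    ((Th (p ^ 25)) ^ 5 - 5 * (2 * cc p 1) * (2 * cc p 3) * (Th (p ^ 25)) ^ 3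
      + 5 * (2 * cc p 1) ^ 2 * (2 * cc p 3) ^ 2 * Th (p ^ 25) + (2 * cc p 1) ^ 5
      + (2 * cc p 3) ^ 5) * Th (p ^ 25) = Th (p ^ 5) ^ 6 := by
  obtain ⟨w, hw⟩ : ∃ w : ℂ, IsPrimitiveRoot w 5 := ⟨_, Complex.isPrimitiveRoot_exp 5 (by norm_num)⟩
  have h5 := hw.pow_eq_one
  have hw0 : w ≠ 0 := by rintro rfl; norm_num at h5
  have hw1 : ‖w‖ = 1 := hw.norm'_eq_one (by norm_num)
  have nn : ∀ n : ℕ, n ≠ 0 → ‖p ^ n‖ < 1 := fun n hn => by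
    rw [norm_pow]; exact pow_lt_one₀ (norm_nonneg p) hp hn
  have hn : ∀ k, ‖w ^ k * p‖ < 1 := fun k => by
    rw [norm_mul, norm_pow, hw1]; simpa using hp
  have hz : ∀ k, w ^ k * p ≠ 0 := fun k => mul_ne_zero (pow_ne_zero _ hw0) hp0
  have hT : ∀ k, Th (w ^ k * p) =
      w ^ (k * 1 ^ 2) * (2 * cc p 1) + w ^ (k * 3 ^ 2) * (2 * cc p 3) + Th (p ^ 25) := by
    intro k
    have a1 := cc_root h5 p 1 k
    have a3 := cc_root h5 p 3 k
    rw [Nat.cast_one] at a1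
    rw [Nat.cast_ofNat] at a3
    have a25 : (w ^ k * p) ^ 25 = p ^ 25 := by
      rw [mul_pow, ← pow_mul, show k * 25 = 5 * (k * 5) by ring, pow_mul, h5, one_pow, one_mul]
    rw [Th_split (hz k) (hn k), a1, a3, a25]
    ring
  rw [← prod_lin hw, ← Finset.prod_congr rfl fun k _ => hT k]
  have hg : ∏ k ∈ Finset.range 5, (Th (w ^ k * p) * qPoch ((w ^ 8) ^ k * p ^ 8) ((w ^ 8) ^ k * p ^ 8))
      = ∏ k ∈ Finset.range 5, (2 * (w ^ k * p) *
        qPoch ((w ^ 16) ^ k * p ^ 16) ((w ^ 16) ^ k * p ^ 16) ^ 2) := by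
    refine Finset.prod_congr rfl fun k _ => ?_
    have := Th_gauss (hz k) (hn k)
    rw [mul_pow, mul_pow, ← pow_mul, ← pow_mul, mul_comm k, mul_comm k, pow_mul, pow_mul] at this
    exact this
  rw [Finset.prod_mul_distrib, Finset.prod_mul_distrib, Finset.prod_pow] at hg
  have hc : ∏ k ∈ Finset.range 5, (2 * (w ^ k * p)) = 32 * p ^ 5 := by
    simp only [Finset.prod_range_succ, Finset.prod_range_zero]
    linear_combination (32 * p ^ 5) * (w ^ 5 + 1) * h5
  rw [hc] at hg
  have g5 := Th_gauss (pow_ne_zero 5 hp0) (nn 5 (by norm_num))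
  have g25 := Th_gauss (pow_ne_zero 25 hp0) (nn 25 (by norm_num))
  have pe := prod_e (pow_prim hw 8 (by norm_num)) (nn 8 (by norm_num))
  have pf := prod_e (pow_prim hw 16 (by norm_num)) (nn 16 (by norm_num))
  have n1 := e_ne_zero (nn 40 (by norm_num))
  have n2 := e_ne_zero (nn 200 (by norm_num))
  have n3 := e_ne_zero (nn 80 (by norm_num))
  have n4 := e_ne_zero (nn 400 (by norm_num))
  simp only [← pow_mul, Nat.reduceMul] at g5 g25 pe pf hg
  generalize (∏ k ∈ Finset.range 5, Th (w ^ k * p)) = T at *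
  generalize Th (p ^ 25) = T25 at *
  generalize Th (p ^ 5) = T5 at *
  generalize qPoch (p ^ 40) (p ^ 40) = e5 at *
  generalize qPoch (p ^ 200) (p ^ 200) = e25 at *
  generalize qPoch (p ^ 80) (p ^ 80) = f5 at *
  generalize qPoch (p ^ 400) (p ^ 400) = f25 at *
  generalize (∏ k ∈ Finset.range 5, qPoch (w ^ (8 * k) * p ^ 8) (w ^ (8 * k) * p ^ 8)) = PE at *
  generalize (∏ k ∈ Finset.range 5, qPoch (w ^ (16 * k) * p ^ 16) (w ^ (16 * k) * p ^ 16)) = PF at *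
  have m : e5 ^ 6 ≠ 0 := pow_ne_zero _ n1
  apply mul_right_cancel₀ m
  calc T * T25 * e5 ^ 6 = (T * PE) * (T25 * e25) := by rw [← pe]; ring
    _ = 64 * p ^ 30 * (PF * f25) ^ 2 := by rw [hg, g25]; ring
    _ = (T5 * e5) ^ 6 := by rw [pf, g5]; ring
    _ = _ := by ring

/-- the eta quotient in terms of `p` -/
lemma V_eq {p : ℂ} (hp0 : p ≠ 0) (hp : ‖p‖ < 1) :
    p ^ 4 * (qPoch (p ^ 8) (p ^ 8) * qPoch (p ^ 80) (p ^ 80) ^ 2) /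
    (qPoch (p ^ 16) (p ^ 16) ^ 2 * qPoch (p ^ 40) (p ^ 40)) = Th (p ^ 5) / Th p := by
  have nn : ∀ n : ℕ, n ≠ 0 → ‖p ^ n‖ < 1 := fun n hn => by
    rw [norm_pow]; exact pow_lt_one₀ (norm_nonneg p) hp hn
  have g1 := Th_gauss hp0 hp
  have g5 := Th_gauss (pow_ne_zero 5 hp0) (nn 5 (by norm_num))
  have n1 := e_ne_zero (nn 40 (by norm_num))
  have n2 := e_ne_zero (nn 16 (by norm_num))
  have n3 := Th_ne hp0 hp
  simp only [← pow_mul, Nat.reduceMul] at g5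
  generalize Th (p ^ 5) = T5 at *
  generalize Th p = T1 at *
  generalize qPoch (p ^ 40) (p ^ 40) = e5 at *
  generalize qPoch (p ^ 80) (p ^ 80) = f5 at *
  generalize qPoch (p ^ 8) (p ^ 8) = e1 at *
  generalize qPoch (p ^ 16) (p ^ 16) = f1 at *
  rw [div_eq_div_iff (mul_ne_zero (pow_ne_zero _ n2) n1) n3]
  apply mul_left_cancel₀ (mul_ne_zero two_ne_zero hp0)
  linear_combination (2 * p ^ 5 * f5 ^ 2) * g1 - (2 * p * f1 ^ 2) * g5

end S16

namespace S16

lemma final_alg (P C s t W : ℂ) (hP : P ≠ 0) (hW : W ≠ 0) (h : W = s + t + C)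
    (e1 : P ^ 2 = C ^ 2 + s * t)
    (e2 : (C ^ 5 - 5 * s * t * C ^ 3 + 5 * s ^ 2 * t ^ 2 * C + s ^ 5 + t ^ 5) * C = P ^ 6) :
    (P / W) ^ 5 - C / P = 5 * (P / W) * (C / P) * Rpoly (P / W) (C / P) := by
  have key : P ^ 6 - C * W ^ 5 = 5 * C * (W * (5 * C ^ 4 - 5 * C ^ 2 * P ^ 2 + (P ^ 2) ^ 2)
      - C * (5 * C ^ 2 - 3 * P ^ 2) * W ^ 2 + (3 * C ^ 2 - P ^ 2) * W ^ 3 - C * W ^ 4) := by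
    rw [← e2, e1, h]
    ring
  have l : (P / W) ^ 5 - C / P = (P ^ 6 - C * W ^ 5) / (W ^ 5 * P) := by
    field_simp
  rw [l, key]
  unfold Rpoly
  field_simp

end S16

/-- Modular equation of level five for `U`: for every `τ ∈ ℍ`,
`U(τ)⁵ − U(5τ) = 5U(τ)U(5τ)·R(U(τ),U(5τ))`. -/
theorem statement16 (τ : UpperHalfPlane) :
    Ufun τ ^ 5 - Ufun (mul5 τ) =
      5 * Ufun τ * Ufun (mul5 τ) * Rpoly (Ufun τ) (Ufun (mul5 τ)) := by
  obtain ⟨p, hpdef⟩ : ∃ p : ℂ, p = Complex.exp (Real.pi * Complex.I * τ / 4) := ⟨_, rfl⟩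
  have hp0 : p ≠ 0 := hpdef ▸ Complex.exp_ne_zero _
  have p4 : Complex.exp (Real.pi * Complex.I * τ) = p ^ 4 := by
    rw [hpdef, ← Complex.exp_nat_mul]
    congr 1; push_cast; ring
  have p8 : Qc τ = p ^ 8 := by
    rw [Qc, hpdef, ← Complex.exp_nat_mul]
    congr 1; push_cast; ring
  have hm : ((mul5 τ : UpperHalfPlane) : ℂ) = 5 * (τ : ℂ) := rfl
  have q4 : Complex.exp (Real.pi * Complex.I * (mul5 τ)) = (p ^ 5) ^ 4 := by
    rw [hm, hpdef, ← Complex.exp_nat_mul, ← Complex.exp_nat_mul]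
    congr 1; push_cast; ring
  have q8 : Qc (mul5 τ) = (p ^ 5) ^ 8 := by
    rw [Qc, hm, hpdef, ← Complex.exp_nat_mul, ← Complex.exp_nat_mul]
    congr 1; push_cast; ring
  have hp : ‖p‖ < 1 := by
    have h1 : ‖Qc τ‖ < 1 := UpperHalfPlane.norm_exp_two_pi_I_lt_one τ
    rw [p8, norm_pow] at h1
    exact lt_of_pow_lt_pow_left₀ 8 zero_le_one (by simpa using h1)
  have hp5 : ‖p ^ 5‖ < 1 := by
    rw [norm_pow]; exact pow_lt_one₀ (norm_nonneg p) hp (by norm_num)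
  have key : ∀ r : ℂ, r ≠ 0 → ‖r‖ < 1 → r ^ 4 *
      (qPoch (r ^ 8) (r ^ 8) * qPoch ((r ^ 8) ^ 10) ((r ^ 8) ^ 10) ^ 2) /
      (qPoch ((r ^ 8) ^ 2) ((r ^ 8) ^ 2) ^ 2 * qPoch ((r ^ 8) ^ 5) ((r ^ 8) ^ 5)) =
      S16.Th (r ^ 5) / S16.Th r := by
    intro r h0 h1
    rw [← S16.V_eq h0 h1]
    rw [← pow_mul r 8 10, ← pow_mul r 8 2, ← pow_mul r 8 5]
  have hX : Ufun τ = S16.Th (p ^ 5) / S16.Th p := by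
    rw [Ufun, p4, p8, key p hp0 hp]
  have hY : Ufun (mul5 τ) = S16.Th (p ^ 25) / S16.Th (p ^ 5) := by
    rw [Ufun, q4, q8, key (p ^ 5) (pow_ne_zero 5 hp0) hp5, ← pow_mul]
  rw [hX, hY]
  exact S16.final_alg _ _ (2 * S16.cc p 1) (2 * S16.cc p 3) _
    (S16.Th_ne (pow_ne_zero 5 hp0) hp5) (S16.Th_ne hp0 hp) (S16.Th_split hp0 hp)
    ((S16.sq_identity hp0 hp).trans (by ring)) (S16.prod_Th hp0 hp)
end

section
/- Let τ ∈ ℍ be an imaginary quadratic point. Then 1/g(τ) and 1/U(τ) are algebraic integers, i.e. integral over ℤ. -/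
open Complex

/-- A point `τ ∈ ℍ` is an imaginary quadratic point if `aτ² + bτ + c = 0` for some
integers `a, b, c` with `a ≠ 0`. -/
def IsImagQuadratic (τ : UpperHalfPlane) : Prop :=
  ∃ a b c : ℤ, a ≠ 0 ∧ (a : ℂ) * (τ : ℂ) ^ 2 + (b : ℂ) * (τ : ℂ) + (c : ℂ) = 0

/-- `g(τ) = (q²;q²)∞²(q⁵;q⁵)∞⁴ / ((q;q)∞⁴(q¹⁰;q¹⁰)∞²)` with `q = e^{2πiτ}`. -/
noncomputable def gfun (τ : UpperHalfPlane) : ℂ :=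
  qPoch (Qc τ ^ 2) (Qc τ ^ 2) ^ 2 * qPoch (Qc τ ^ 5) (Qc τ ^ 5) ^ 4 /
    (qPoch (Qc τ) (Qc τ) ^ 4 * qPoch (Qc τ ^ 10) (Qc τ ^ 10) ^ 2)

namespace EtaCM

open Filter Topology PowerSeries

local notation "SLZ" => Matrix.SpecialLinearGroup (Fin 2) ℤ
local notation "ℍ" => UpperHalfPlane

section Part1



/-! ### Convergent power series with algebraic integer coefficients -/

/-- The ring of algebraic integers in `ℂ`. -/
noncomputable abbrev AI : Subalgebra ℤ ℂ := integralClosure ℤ ℂ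

/-- Power series convergent on the open unit disc. -/
def Conv (p : PowerSeries ℂ) : Prop :=
  ∀ z : ℂ, ‖z‖ < 1 → Summable fun k => ‖p.coeff k * z ^ k‖

/-- Evaluation of a power series. -/
noncomputable def ev (p : PowerSeries ℂ) (z : ℂ) : ℂ := ∑' k, p.coeff k * z ^ k

lemma Conv.hasSum {p : PowerSeries ℂ} (hp : Conv p) {z : ℂ} (hz : ‖z‖ < 1) :
    HasSum (fun k => p.coeff k * z ^ k) (ev p z) := (hp z hz).of_norm.hasSum

lemma conv_of_hasSum {p : PowerSeries ℂ} {f : ℂ → ℂ}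
    (h : ∀ z : ℂ, ‖z‖ < 1 → HasSum (fun k => p.coeff k * z ^ k) (f z)) : Conv p :=
  fun z hz => (h z hz).summable.norm

lemma ev_eq_of_hasSum {p : PowerSeries ℂ} {z w : ℂ}
    (h : HasSum (fun k => p.coeff k * z ^ k) w) : ev p z = w := h.tsum_eq

lemma mul_term (p r : PowerSeries ℂ) (z : ℂ) (n : ℕ) :
    (p * r).coeff n * z ^ n = ∑ kl ∈ Finset.HasAntidiagonal.antidiagonal n,
      (p.coeff kl.1 * z ^ kl.1) * (r.coeff kl.2 * z ^ kl.2) := by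
  rw [PowerSeries.coeff_mul, Finset.sum_mul]
  refine Finset.sum_congr rfl fun kl hkl => ?_
  rw [← Finset.HasAntidiagonal.mem_antidiagonal.mp hkl, pow_add]
  ring

lemma Conv.mul {p r : PowerSeries ℂ} (hp : Conv p) (hr : Conv r) : Conv (p * r) := by
  intro z hz
  refine (summable_norm_sum_mul_antidiagonal_of_summable_norm (hp z hz) (hr z hz)).congr fun n => ?_
  rw [mul_term]

lemma ev_mul {p r : PowerSeries ℂ} (hp : Conv p) (hr : Conv r) {z : ℂ} (hz : ‖z‖ < 1) :
    ev (p * r) z = ev p z * ev r z := by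
  have h := tsum_mul_tsum_eq_tsum_sum_antidiagonal_of_summable_norm (hp z hz) (hr z hz)
  exact (tsum_congr fun n => mul_term p r z n).trans h.symm

lemma hasSum_add {p r : PowerSeries ℂ} (hp : Conv p) (hr : Conv r) {z : ℂ} (hz : ‖z‖ < 1) :
    HasSum (fun k => (p + r).coeff k * z ^ k) (ev p z + ev r z) := by
  simpa [add_mul] using (hp.hasSum hz).add (hr.hasSum hz)

lemma hasSum_C (a z : ℂ) : HasSum (fun k => (PowerSeries.C a).coeff k * z ^ k) a := by
  convert hasSum_ite_eq 0 a using 2 with k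
  by_cases h : k = 0 <;> simp [h, PowerSeries.coeff_C]

lemma hasSum_X (z : ℂ) : HasSum (fun k => (PowerSeries.X : PowerSeries ℂ).coeff k * z ^ k) z := by
  convert hasSum_ite_eq 1 z using 2 with k
  by_cases h : k = 1 <;> simp [h, PowerSeries.coeff_X]

/-- Convergent power series with algebraic integer coefficients. -/
def Good (p : PowerSeries ℂ) : Prop := (∀ k, p.coeff k ∈ AI) ∧ Conv p

lemma Good.mul {p r : PowerSeries ℂ} (hp : Good p) (hr : Good r) : Good (p * r) := by
  refine ⟨fun k => ?_, hp.2.mul hr.2⟩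
  rw [PowerSeries.coeff_mul]
  exact sum_mem fun i _ => mul_mem (hp.1 _) (hr.1 _)

lemma Good.add {p r : PowerSeries ℂ} (hp : Good p) (hr : Good r) : Good (p + r) :=
  ⟨fun k => by simpa using add_mem (hp.1 k) (hr.1 k),
    conv_of_hasSum fun _ hz => hasSum_add hp.2 hr.2 hz⟩

lemma ev_add {p r : PowerSeries ℂ} (hp : Conv p) (hr : Conv r) {z : ℂ} (hz : ‖z‖ < 1) :
    ev (p + r) z = ev p z + ev r z := ev_eq_of_hasSum (hasSum_add hp hr hz)

lemma good_C {a : ℂ} (ha : a ∈ AI) : Good (PowerSeries.C a) :=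
  ⟨fun k => by
    rw [PowerSeries.coeff_C]; split_ifs
    · exact ha
    · exact zero_mem _, conv_of_hasSum fun z _ => hasSum_C a z⟩

lemma ev_C (a z : ℂ) : ev (PowerSeries.C a) z = a := ev_eq_of_hasSum (hasSum_C a z)

lemma good_X : Good PowerSeries.X :=
  ⟨fun k => by
    rw [PowerSeries.coeff_X]; split_ifs
    · exact one_mem _
    · exact zero_mem _, conv_of_hasSum fun z _ => hasSum_X z⟩

lemma ev_X (z : ℂ) : ev PowerSeries.X z = z := ev_eq_of_hasSum (hasSum_X z)

lemma good_one : Good 1 := by simpa using good_C (one_mem AI)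

lemma ev_one (z : ℂ) : ev 1 z = 1 := by simpa using ev_C 1 z

lemma Good.pow {p : PowerSeries ℂ} (hp : Good p) (n : ℕ) : Good (p ^ n) := by
  induction n with
  | zero => simpa using good_one
  | succ n ih => rw [pow_succ]; exact ih.mul hp

lemma ev_pow {p : PowerSeries ℂ} (hp : Good p) (n : ℕ) {z : ℂ} (hz : ‖z‖ < 1) :
    ev (p ^ n) z = ev p z ^ n := by
  induction n with
  | zero => simpa using ev_one z
  | succ n ih => rw [pow_succ, pow_succ, ev_mul (hp.pow n).2 hp.2 hz, ih]

/-- The formal multilinear series attached to a convergent power series. -/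
lemma Conv.hasFPowerSeriesOnBall {p : PowerSeries ℂ} (hp : Conv p) :
    HasFPowerSeriesOnBall (ev p) (FormalMultilinearSeries.ofScalars ℂ fun k => p.coeff k) 0 1 := by
  refine ⟨?_, by simp, ?_⟩
  · refine ENNReal.le_of_forall_nnreal_lt fun r hr => ?_
    apply FormalMultilinearSeries.le_radius_of_summable
    have hr' : (r : ℝ) < 1 := by exact_mod_cast hr
    have := hp (r : ℝ) (by simpa using hr')
    simpa [FormalMultilinearSeries.ofScalars_norm] using this
  · intro y hy
    have hy' : ‖y‖ < 1 := by
      rw [Metric.mem_eball, edist_zero_right] at hy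
      simpa [enorm_eq_nnnorm] using! hy
    simpa [FormalMultilinearSeries.ofScalars_apply_eq, mul_comm] using hp.hasSum hy'

lemma Conv.differentiableOn {p : PowerSeries ℂ} (hp : Conv p) :
    DifferentiableOn ℂ (ev p) (Metric.ball 0 1) := by
  have := hp.hasFPowerSeriesOnBall.differentiableOn
  rwa [show (1 : ENNReal) = ENNReal.ofReal 1 by simp, Metric.eball_ofReal] at this

lemma ev_zero (p : PowerSeries ℂ) : ev p 0 = p.coeff 0 := by
  refine ev_eq_of_hasSum ?_
  convert hasSum_ite_eq 0 (p.coeff 0) using 2 with k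
  by_cases h : k = 0 <;> simp [h]

lemma Conv.tendsto_zero {p : PowerSeries ℂ} (hp : Conv p) :
    Tendsto (ev p) (𝓝 0) (𝓝 (p.coeff 0)) := by
  rw [← ev_zero]
  exact (hp.differentiableOn.differentiableAt (Metric.ball_mem_nhds _ one_pos)).continuousAt

lemma ev_injective {p r : PowerSeries ℂ} (hp : Conv p) (hr : Conv r)
    (h : ∀ z : ℂ, ‖z‖ < 1 → ev p z = ev r z) : p = r := by
  have h1 := hp.hasFPowerSeriesOnBall.hasFPowerSeriesAt
  have h2 := hr.hasFPowerSeriesOnBall.hasFPowerSeriesAt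
  have h3 : ev p =ᶠ[𝓝 0] ev r := by
    filter_upwards [Metric.ball_mem_nhds (0 : ℂ) one_pos] with z hz
    exact h z (by simpa using hz)
  have h4 := (h1.congr h3).eq_formalMultilinearSeries h2
  have h5 := FormalMultilinearSeries.ofScalars_series_injective ℂ ℂ h4
  ext k
  exact congrFun h5 k

/-- Substitution `z ↦ ζ z^k` in a power series. -/
noncomputable def subst (ζ : ℂ) (k : ℕ) (p : PowerSeries ℂ) : PowerSeries ℂ :=
  PowerSeries.mk fun i => if k ∣ i then p.coeff (i / k) * ζ ^ (i / k) else 0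

lemma hasSum_subst {ζ : ℂ} {k : ℕ} (hk : 0 < k) (hζ : ‖ζ‖ = 1) {p : PowerSeries ℂ} (hp : Conv p)
    {z : ℂ} (hz : ‖z‖ < 1) :
    HasSum (fun i => (subst ζ k p).coeff i * z ^ i) (ev p (ζ * z ^ k)) := by
  have hinj : Function.Injective fun i : ℕ => k * i := fun a b h => Nat.eq_of_mul_eq_mul_left hk h
  have hz' : ‖ζ * z ^ k‖ < 1 := by
    rw [norm_mul, hζ, one_mul, norm_pow]
    exact pow_lt_one₀ (norm_nonneg _) hz hk.ne'
  refine (hinj.hasSum_iff ?_).mp ?_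
  · intro i hi
    have : ¬ k ∣ i := fun ⟨c, hc⟩ => hi ⟨c, hc.symm⟩
    simp [subst, this]
  · convert hp.hasSum hz' using 2 with i
    simp [subst, Nat.mul_div_cancel_left _ hk, mul_pow, ← pow_mul, mul_assoc]

lemma good_subst {ζ : ℂ} {k : ℕ} (hk : 0 < k) (hζ : ‖ζ‖ = 1) (hζ' : ζ ∈ AI) {p : PowerSeries ℂ}
    (hp : Good p) : Good (subst ζ k p) := by
  refine ⟨fun i => ?_, conv_of_hasSum fun z hz => hasSum_subst hk hζ hp.2 hz⟩
  simp only [subst, PowerSeries.coeff_mk]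
  split_ifs
  · exact mul_mem (hp.1 _) (pow_mem hζ' _)
  · exact zero_mem _

lemma coeff_zero_subst (ζ : ℂ) (k : ℕ) (p : PowerSeries ℂ) :
    (subst ζ k p).coeff 0 = p.coeff 0 := by simp [subst]

/-! ### The eta product -/

lemma exists_of_differentiableOn {h : ℂ → ℂ} (hh : DifferentiableOn ℂ h (Metric.ball 0 1)) :
    ∃ p : PowerSeries ℂ, Conv p ∧ (∀ z : ℂ, ‖z‖ < 1 → ev p z = h z) ∧
      ∀ k, p.coeff k = (k.factorial : ℂ)⁻¹ * iteratedDeriv k h 0 := by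
  set p : PowerSeries ℂ := PowerSeries.mk fun k => (k.factorial : ℂ)⁻¹ * iteratedDeriv k h 0
  have key : ∀ z : ℂ, ‖z‖ < 1 → HasSum (fun k => p.coeff k * z ^ k) (h z) := by
    intro z hz
    have h1 := Complex.hasSum_taylorSeries_on_ball hh (z := z) (by simpa using hz)
    have e : (fun k => p.coeff k * z ^ k) =
        fun n => ((n.factorial : ℂ))⁻¹ • (z - 0) ^ n • iteratedDeriv n h 0 := by
      funext k
      rw [PowerSeries.coeff_mk, sub_zero, smul_eq_mul, smul_eq_mul]; ring
    rw [e]; exact h1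
  exact ⟨p, conv_of_hasSum key, fun z hz => ev_eq_of_hasSum (key z hz), fun k => by simp [p]⟩

lemma iteratedDeriv_poly (P : Polynomial ℤ) (k : ℕ) :
    (k.factorial : ℂ)⁻¹ * iteratedDeriv k (fun z : ℂ => (P.map (Int.castRingHom ℂ)).eval z) 0
      = (P.coeff k : ℂ) := by
  have h1 : ∀ (Q : Polynomial ℂ) (k : ℕ), iteratedDeriv k (fun z : ℂ => Q.eval z)
      = fun z => (Polynomial.derivative^[k] Q).eval z := by
    intro Q k
    induction k with
    | zero => simp
    | succ k ih =>
      rw [iteratedDeriv_succ, ih]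
      ext z
      rw [Polynomial.deriv, Function.iterate_succ_apply']
  have h2 : (k.factorial : ℂ) ≠ 0 := by exact_mod_cast k.factorial_ne_zero
  rw [h1]
  simp only
  rw [← Polynomial.coeff_zero_eq_eval_zero, Polynomial.coeff_iterate_derivative]
  simp [Nat.descFactorial_self]
  field_simp

lemma tlu_iteratedDeriv {ι : Type*} {φ : Filter ι} {F : ι → ℂ → ℂ} {f : ℂ → ℂ} {U : Set ℂ}
    (hU : IsOpen U) (hF : ∀ i, DifferentiableOn ℂ (F i) U)
    (h : TendstoLocallyUniformlyOn F f φ U) (k : ℕ) :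
    TendstoLocallyUniformlyOn (fun i => iteratedDeriv k (F i)) (iteratedDeriv k f) φ U := by
  have hd : ∀ i k, DifferentiableOn ℂ (iteratedDeriv k (F i)) U := by
    intro i k
    induction k with
    | zero => simpa using hF i
    | succ k ih => rw [iteratedDeriv_succ]; exact ih.deriv hU
  induction k with
  | zero => simpa using h
  | succ k ih =>
    simp_rw [iteratedDeriv_succ]
    exact ih.deriv (Eventually.of_forall fun i => hd i k) hU

lemma eulerProd_ne_zero {z : ℂ} (hz : ‖z‖ < 1) : ∏' n : ℕ, (1 - z ^ (n + 1)) ≠ 0 := by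
  have := tprod_one_add_ne_zero_of_summable (f := fun n : ℕ => -z ^ (n + 1)) ?_ ?_
  · simpa [sub_eq_add_neg] using this
  · intro i h
    have h1 : z ^ (i + 1) = 1 := by linear_combination -h
    have h2 : ‖z‖ ^ (i + 1) < 1 := pow_lt_one₀ (norm_nonneg _) hz (by omega)
    rw [← norm_pow, h1] at h2
    simp at h2
  · simpa using (summable_nat_add_iff 1).mpr (summable_geometric_of_lt_one (norm_nonneg _) hz)

lemma exists_euler : ∃ p : PowerSeries ℂ, Good p ∧ p.coeff 0 = 1 ∧
    ∀ z : ℂ, ‖z‖ < 1 → ev p z = ∏' n : ℕ, (1 - z ^ (n + 1)) := by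
  obtain ⟨p, hp, hev, hco⟩ := exists_of_differentiableOn
    ModularForm.differentiableOn_tprod_one_sub_pow
  refine ⟨p, ⟨fun k => ?_, hp⟩, ?_, hev⟩
  · have h := ModularForm.multipliableLocallyUniformlyOn_one_sub_pow.hasProdLocallyUniformlyOn
    have h2 : TendstoLocallyUniformlyOn (fun (s : Finset ℕ) (z : ℂ) => ∏ n ∈ s, (1 - z ^ (n + 1)))
        (fun z => ∏' n : ℕ, (1 - z ^ (n + 1))) atTop (Metric.ball 0 1) := by
      simpa [HasProdLocallyUniformlyOn] using! h
    have h3 := (tlu_iteratedDeriv Metric.isOpen_ball (fun s => by fun_prop) h2 k).tendsto_at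
      (Metric.mem_ball_self one_pos)
    have h4 := h3.const_mul ((k.factorial : ℂ)⁻¹)
    rw [← hco] at h4
    have hcl : IsClosed (Set.range ((↑) : ℤ → ℂ)) := Complex.isClosed_range_intCast
    have hmem : p.coeff k ∈ Set.range ((↑) : ℤ → ℂ) := by
      refine hcl.mem_of_tendsto h4 (Eventually.of_forall fun s => ?_)
      refine ⟨(∏ n ∈ s, (1 - Polynomial.X ^ (n + 1)) : Polynomial ℤ).coeff k, ?_⟩
      rw [← iteratedDeriv_poly]
      simp [Polynomial.map_prod, Polynomial.eval_prod]
    obtain ⟨n, hn⟩ := hmem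
    rw [← hn]
    exact isIntegral_algebraMap (R := ℤ) (A := ℂ) (x := n)
  · rw [← ev_zero, hev 0 (by simp)]
    simp

/-- Inverse of a good nonvanishing power series with constant coefficient one. -/
lemma exists_inv {p : PowerSeries ℂ} (hp : Good p) (h0 : p.coeff 0 = 1)
    (hne : ∀ z : ℂ, ‖z‖ < 1 → ev p z ≠ 0) :
    ∃ r : PowerSeries ℂ, Good r ∧ r.coeff 0 = 1 ∧ ∀ z : ℂ, ‖z‖ < 1 → ev r z = (ev p z)⁻¹ := by
  obtain ⟨r, hr, hev, -⟩ := exists_of_differentiableOn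
    (hp.2.differentiableOn.inv fun z hz => hne z (by simpa using hz))
  have hmul : r * p = 1 := by
    refine ev_injective (hr.mul hp.2) good_one.2 fun z hz => ?_
    rw [ev_mul hr hp.2 hz, hev z hz, ev_one, Pi.inv_apply, inv_mul_cancel₀ (hne z hz)]
  have hrec : ∀ n, r.coeff n = (1 : PowerSeries ℂ).coeff n -
      ∑ k ∈ Finset.range n, r.coeff k * p.coeff (n - k) := by
    intro n
    rw [← hmul, PowerSeries.coeff_mul,
      Finset.Nat.sum_antidiagonal_eq_sum_range_succ (fun i j => r.coeff i * p.coeff j),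
      Finset.sum_range_succ]
    simp only [Nat.sub_self, h0]
    ring
  refine ⟨r, ⟨fun n => ?_, hr⟩, ?_, hev⟩
  · induction n using Nat.strong_induction_on with
    | _ n ih =>
      rw [hrec]
      refine sub_mem (good_one.1 n) (sum_mem fun k hk => mul_mem (ih k ?_) (hp.1 _))
      simpa using hk
  · rw [hrec]; simp


end Part1

section Part2




/-! ### Laurent expansions at infinity -/

/-- The local parameter of level `N`. -/
noncomputable def qq (N : ℕ) (τ : ℍ) : ℂ := Function.Periodic.qParam (N : ℝ) (τ : ℂ)

lemma qq_ne_zero (N : ℕ) (τ : ℍ) : qq N τ ≠ 0 := Function.Periodic.qParam_ne_zero _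

lemma norm_qq (N : ℕ) [NeZero N] (τ : ℍ) : ‖qq N τ‖ < 1 := UpperHalfPlane.norm_qParam_lt_one N τ

lemma qq_tendsto (N : ℕ) [NeZero N] : Tendsto (qq N) UpperHalfPlane.atImInfty (𝓝 0) :=
  UpperHalfPlane.qParam_tendsto_atImInfty (h := (N : ℝ)) (by exact_mod_cast Nat.pos_of_neZero N)

/-- `f` has a Laurent expansion in the parameter of level `N`, of order at least `-m`, with
algebraic integer coefficients. -/
def HasE (N m : ℕ) (p : PowerSeries ℂ) (f : ℍ → ℂ) : Prop :=
  Good p ∧ ∀ τ, qq N τ ^ m * f τ = ev p (qq N τ)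

section
variable {N m m' : ℕ} [NeZero N] {p r : PowerSeries ℂ} {f g : ℍ → ℂ}

lemma HasE.mul (hf : HasE N m p f) (hg : HasE N m' r g) :
    HasE N (m + m') (p * r) (fun τ => f τ * g τ) := by
  refine ⟨hf.1.mul hg.1, fun τ => ?_⟩
  rw [ev_mul hf.1.2 hg.1.2 (norm_qq N τ), ← hf.2, ← hg.2]
  ring

lemma HasE.shift (hf : HasE N m p f) (k : ℕ) : HasE N (m + k) (PowerSeries.X ^ k * p) f := by
  refine ⟨(good_X.pow k).mul hf.1, fun τ => ?_⟩
  rw [ev_mul (good_X.pow k).2 hf.1.2 (norm_qq N τ), ← hf.2, ev_pow good_X _ (norm_qq N τ), ev_X]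
  ring

lemma HasE.congr (hf : HasE N m p f) (h : ∀ τ, g τ = f τ) : HasE N m p g :=
  ⟨hf.1, fun τ => by rw [h, hf.2]⟩

lemma HasE.add_same (hf : HasE N m p f) (hg : HasE N m r g) :
    HasE N m (p + r) (fun τ => f τ + g τ) := by
  refine ⟨hf.1.add hg.1, fun τ => ?_⟩
  rw [ev_add hf.1.2 hg.1.2 (norm_qq N τ), ← hf.2, ← hg.2]
  ring

lemma hasE_const {a : ℂ} (ha : a ∈ AI) : HasE N 0 (PowerSeries.C a) (fun _ => a) :=
  ⟨good_C ha, fun τ => by rw [ev_C]; ring⟩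

lemma HasE.pow (hf : HasE N m p f) (k : ℕ) :
    HasE N (k * m) (p ^ k) (fun τ => f τ ^ k) := by
  refine ⟨hf.1.pow k, fun τ => ?_⟩
  rw [ev_pow hf.1 _ (norm_qq N τ), ← hf.2, mul_pow, pow_mul']

lemma hasE_prod {ι : Type*} (s : Finset ι) (m : ι → ℕ) (p : ι → PowerSeries ℂ) (f : ι → ℍ → ℂ)
    (h : ∀ i ∈ s, HasE N (m i) (p i) (f i)) :
    HasE N (∑ i ∈ s, m i) (∏ i ∈ s, p i) (fun τ => ∏ i ∈ s, f i τ) := by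
  classical
  induction s using Finset.induction_on with
  | empty => simpa using hasE_const (N := N) (one_mem AI)
  | insert a s ha ih =>
    simp only [Finset.prod_insert ha, Finset.sum_insert ha]
    exact (h a (by simp)).mul (ih fun i hi => h i (by simp [hi]))

/-- substitution -/
lemma HasE.comp {N m : ℕ} [NeZero N] {p : PowerSeries ℂ} {f : ℍ → ℂ}
    (hf : HasE 1 m p f) (g : ℍ → ℍ) {ζ : ℂ} {k : ℕ} (hk : 0 < k) (hζ : ‖ζ‖ = 1)
    (hζ1 : ζ ∈ AI) (hζ2 : ζ⁻¹ ∈ AI)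
    (h : ∀ τ, qq 1 (g τ) = ζ * qq N τ ^ k) :
    HasE N (k * m) (PowerSeries.C (ζ⁻¹ ^ m) * subst ζ k p) (fun τ => f (g τ)) := by
  have h0 : ζ ≠ 0 := by rintro rfl; simp at hζ
  have hg := good_subst hk hζ hζ1 hf.1
  have hc := good_C (pow_mem hζ2 m)
  refine ⟨hc.mul hg, fun τ => ?_⟩
  rw [ev_mul hc.2 hg.2 (norm_qq N τ), ev_C, ev_eq_of_hasSum (hasSum_subst hk hζ hf.1.2 (norm_qq N τ)),
    ← h, ← hf.2, h, mul_pow, ← pow_mul, ← mul_assoc, ← mul_assoc, ← mul_pow, inv_mul_cancel₀ h0]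
  simp

lemma HasE.add (hf : HasE N m p f) (hg : HasE N m' r g) :
    ∃ s, HasE N (m + m') s (fun τ => f τ + g τ) :=
  ⟨_, (hf.shift m').add_same ((add_comm m' m) ▸ hg.shift m)⟩

lemma HasE.tendsto (hf : HasE N m p f) :
    Tendsto (fun τ => qq N τ ^ m * f τ) UpperHalfPlane.atImInfty (𝓝 (p.coeff 0)) := by
  simp_rw [hf.2]
  exact hf.1.2.tendsto_zero.comp (qq_tendsto N)

end

/-- Functions having some expansion of level `N`. -/
def Ls (N : ℕ) [NeZero N] : Subring (ℍ → ℂ) where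
  carrier := {f | ∃ m p, HasE N m p f}
  mul_mem' := by
    rintro f g ⟨m, p, h⟩ ⟨m', p', h'⟩
    exact ⟨_, _, h.mul h'⟩
  add_mem' := by
    rintro f g ⟨m, p, h⟩ ⟨m', p', h'⟩
    obtain ⟨s, hs⟩ := h.add h'
    exact ⟨_, _, hs⟩
  one_mem' := ⟨0, _, hasE_const (one_mem AI)⟩
  zero_mem' := ⟨0, _, hasE_const (zero_mem AI)⟩
  neg_mem' := by
    rintro f ⟨m, p, h⟩
    exact ⟨_, _, ((hasE_const (N := N) (neg_mem (one_mem AI))).mul h).congr fun τ => by simp⟩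

lemma mem_Ls {N : ℕ} [NeZero N] {f : ℍ → ℂ} : f ∈ Ls N ↔ ∃ m p, HasE N m p f := Iff.rfl

/-- Invariance under the full modular group. -/
def Inv (f : ℍ → ℂ) : Prop :=
  ∀ (γ : Matrix.SpecialLinearGroup (Fin 2) ℤ) (τ : ℍ), f (γ • τ) = f τ

instance : UpperHalfPlane.atImInfty.NeBot := by infer_instance

open scoped MatrixGroups ModularForm in
lemma const_of_hasE {N : ℕ} [NeZero N] {p : PowerSeries ℂ} {f : ℍ → ℂ} (hf : HasE N 0 p f)
    (hi : Inv f) (τ : ℍ) : f τ = p.coeff 0 := by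
  have hsl : ∀ γ : Matrix.SpecialLinearGroup (Fin 2) ℤ, f ∣[(0 : ℤ)] γ = f := by
    intro γ
    ext τ
    rw [ModularForm.SL_slash_apply]
    simpa using hi γ τ
  have hlim : Tendsto f UpperHalfPlane.atImInfty (𝓝 (p.coeff 0)) := by
    simpa using hf.tendsto
  let F : ModularForm 𝒮ℒ 0 :=
    { toFun := f
      slash_action_eq' := by
        rintro A ⟨A, rfl⟩
        exact hsl A
      holo' := by
        rw [UpperHalfPlane.mdifferentiable_iff]
        have h1 : DifferentiableOn ℂ (fun z => ev p (Function.Periodic.qParam (N : ℝ) z))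
            {z | 0 < z.im} := by
          refine hf.1.2.differentiableOn.comp
            (Function.Periodic.differentiable_qParam (h := (N : ℝ))).differentiableOn ?_
          intro z hz
          have := norm_qq N ⟨z, hz⟩
          rw [qq] at this
          simpa using this
        refine h1.congr fun z hz => ?_
        have := hf.2 ⟨z, hz⟩
        simp only [pow_zero, one_mul] at this
        simp only [Function.comp, UpperHalfPlane.ofComplex_apply_of_im_pos hz]
        exact this
      bdd_at_cusps' := by
        intro c hc
        rw [Subgroup.IsArithmetic.isCusp_iff_isCusp_SL2Z] at hc
        rw [OnePoint.isBoundedAt_iff_forall_SL2Z hc]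
        intro γ _
        rw [hsl]
        exact hlim.isBigO_one ℝ }
  obtain ⟨c, hc⟩ := ModularFormClass.levelOne_weight_zero_const F
  have hc' : f = Function.const _ c := hc
  rw [hc'] at hlim ⊢
  exact tendsto_nhds_unique tendsto_const_nhds hlim

lemma qq_T (N : ℕ) [NeZero N] (τ : ℍ) :
    qq N (ModularGroup.T • τ) = Complex.exp (2 * Real.pi * Complex.I / N) * qq N τ := by
  rw [UpperHalfPlane.modular_T_smul]
  simp only [qq, Function.Periodic.qParam, UpperHalfPlane.coe_vadd, ← Complex.exp_add]
  congr 1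
  push_cast
  ring

lemma T_tendsto : Tendsto (fun τ : ℍ => ModularGroup.T • τ) UpperHalfPlane.atImInfty
    UpperHalfPlane.atImInfty := by
  rw [UpperHalfPlane.atImInfty, tendsto_comap_iff]
  refine Tendsto.congr (f₁ := UpperHalfPlane.im) (fun τ => ?_) tendsto_comap
  change _ = (ModularGroup.T • τ).im
  rw [UpperHalfPlane.modular_T_smul]
  simp

lemma dvd_of_leading {N m : ℕ} [NeZero N] {p : PowerSeries ℂ} {f : ℍ → ℂ} (hf : HasE N m p f)
    (hi : Inv f) (h0 : p.coeff 0 ≠ 0) : N ∣ m := by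
  set ζ := Complex.exp (2 * Real.pi * Complex.I / N)
  have h1 := hf.tendsto.comp T_tendsto
  have h2 : Tendsto (fun τ => ζ ^ m * (qq N τ ^ m * f τ)) UpperHalfPlane.atImInfty
    (𝓝 (ζ ^ m * p.coeff 0)) := hf.tendsto.const_mul _
  have h3 : ((fun τ => qq N τ ^ m * f τ) ∘ fun τ : ℍ => ModularGroup.T • τ)
      = fun τ => ζ ^ m * (qq N τ ^ m * f τ) := by
    ext τ
    simp only [Function.comp]
    rw [hi, qq_T, mul_pow, mul_assoc]
  rw [h3] at h1
  have h4 := tendsto_nhds_unique h1 h2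
  have h5 : ζ ^ m = 1 := by
    field_simp at h4
    exact h4.symm
  exact (Complex.isPrimitiveRoot_exp N (NeZero.ne N)).dvd_of_pow_eq_one m h5


end Part2

section Part3




/-! ### The functions `Δ`, `E₄`, `j` -/

lemma c0_mul (p r : PowerSeries ℂ) : (p * r).coeff 0 = p.coeff 0 * r.coeff 0 := by simp

lemma c0_pow (p : PowerSeries ℂ) (k : ℕ) : (p ^ k).coeff 0 = p.coeff 0 ^ k := by simp

lemma qq_one (τ : ℍ) : qq 1 τ = Function.Periodic.qParam 1 (τ : ℂ) := by simp [qq]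

lemma disc_eq {p : PowerSeries ℂ} (hp : ∀ z : ℂ, ‖z‖ < 1 → ev p z = ∏' n : ℕ, (1 - z ^ (n + 1)))
    (τ : ℍ) : ModularForm.discriminant τ = qq 1 τ * ev p (qq 1 τ) ^ 24 := by
  rw [ModularForm.discriminant_eq_q_prod, hp _ (norm_qq 1 τ), qq_one,
    ← (ModularForm.multipliable_one_sub_pow (by simpa [qq_one] using norm_qq 1 τ)).tprod_pow]

/-- The normalised Eisenstein series of weight four. -/
noncomputable def E4 : ℍ → ℂ := ModularForm.E (k := 4) (by norm_num : 3 ≤ 4)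

open scoped MatrixGroups in
lemma hasE_E4 : ∃ p, HasE 1 0 p E4 ∧ p.coeff 0 = 1 := by
  have hcoef := EisensteinSeries.E_qExpansion_coeff (k := 4) (by norm_num) (by decide)
  set p := UpperHalfPlane.qExpansion 1 (ModularForm.E (k := 4) (by norm_num : 3 ≤ 4)) with hp
  have hb : bernoulli 4 = -1 / 30 := by
    rw [bernoulli_eq_bernoulli'_of_ne_one (by norm_num), bernoulli'_four]
  refine ⟨p, ⟨⟨fun k => ?_, ?_⟩, fun τ => ?_⟩, by simpa using hcoef 0⟩
  · rw [hcoef, hb]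
    split_ifs
    · exact one_mem _
    · refine mul_mem ?_ (natCast_mem _ _)
      have : (-(2 * (4 : ℕ) / ((-1 / 30 : ℚ) : ℂ)) : ℂ) = (240 : ℕ) := by push_cast; norm_num
      rw [this]
      exact natCast_mem _ _
  · refine conv_of_hasSum (f := UpperHalfPlane.cuspFunction 1
      (ModularForm.E (k := 4) (by norm_num : 3 ≤ 4))) fun z hz => ?_
    exact UpperHalfPlane.hasSum_qExpansion_of_norm_lt (h := 1) one_pos
      (SlashInvariantFormClass.periodic_comp_ofComplex _ one_mem_strictPeriods_SL)
      (ModularFormClass.holo _) (ModularFormClass.bdd_at_infty _) hz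
  · have := ModularForm.hasSum_qExpansion (h := 1)
      (ModularForm.E (k := 4) (by norm_num : 3 ≤ 4)) one_pos one_mem_strictPeriods_SL τ
    rw [qq_one, ev_eq_of_hasSum this, pow_zero, one_mul]
    rfl

lemma hasE_disc : ∃ p, HasE 1 0 p ModularForm.discriminant := by
  obtain ⟨p, h1, h2, h3⟩ := exists_euler
  refine ⟨PowerSeries.X * p ^ 24, good_X.mul (h1.pow 24), fun τ => ?_⟩
  rw [ev_mul good_X.2 (h1.pow 24).2 (norm_qq 1 τ), ev_X, ev_pow h1 _ (norm_qq 1 τ), disc_eq h3]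
  simp

lemma hasE_disc_inv : ∃ p, HasE 1 1 p (fun τ => (ModularForm.discriminant τ)⁻¹) ∧
    p.coeff 0 = 1 := by
  obtain ⟨p, h1, h2, h3⟩ := exists_euler
  obtain ⟨r, hr1, hr2, hr3⟩ := exists_inv h1 h2 (fun z hz => by
    rw [h3 z hz]; exact eulerProd_ne_zero hz)
  refine ⟨r ^ 24, ⟨hr1.pow 24, fun τ => ?_⟩, by rw [c0_pow, hr2, one_pow]⟩
  change qq 1 τ ^ 1 * (ModularForm.discriminant τ)⁻¹ = _
  rw [ev_pow hr1 _ (norm_qq 1 τ), disc_eq h3, hr3 _ (norm_qq 1 τ)]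
  have := qq_ne_zero 1 τ
  rw [mul_inv, ← mul_assoc, pow_one, mul_inv_cancel₀ this, one_mul, inv_pow]

/-- The modular invariant. -/
noncomputable def jj (τ : ℍ) : ℂ := E4 τ ^ 3 * (ModularForm.discriminant τ)⁻¹

lemma hasE_jj : ∃ p, HasE 1 1 p jj ∧ p.coeff 0 = 1 := by
  obtain ⟨p, hp, hp0⟩ := hasE_E4
  obtain ⟨r, hr, hr0⟩ := hasE_disc_inv
  exact ⟨_, (hp.pow 3).mul hr, by rw [c0_mul, c0_pow, hp0, hr0]; norm_num⟩

open scoped MatrixGroups ModularForm in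
lemma disc_slash (γ : SL(2, ℤ)) :
    ModularForm.discriminant ∣[(12 : ℤ)] γ = ModularForm.discriminant :=
  SlashInvariantForm.slash_action_generators_SL2Z ModularForm.discriminant_S_invariant
    ModularForm.discriminant_T_invariant γ

open scoped MatrixGroups ModularForm in
lemma E4_slash (γ : SL(2, ℤ)) : E4 ∣[(4 : ℤ)] γ = E4 :=
  SlashInvariantForm.slash_action_eqn (ModularForm.E (k := 4) (by norm_num : 3 ≤ 4)) _ ⟨γ, rfl⟩

lemma inv_jj : Inv jj := by
  intro γ τ
  have h1 := congrFun (E4_slash γ) τ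
  have h2 := congrFun (disc_slash γ) τ
  rw [ModularForm.SL_slash_apply] at h1 h2
  have h0 := UpperHalfPlane.denom_ne_zero (γ : GL (Fin 2) ℝ) τ
  rw [jj, jj, ← h1, ← h2, zpow_neg, zpow_neg]
  have h3 := ModularForm.discriminant_ne_zero (γ • τ)
  generalize UpperHalfPlane.denom (γ : GL (Fin 2) ℝ) τ = x at *
  generalize E4 (γ • τ) = y
  generalize ModularForm.discriminant (γ • τ) = w at h3
  have e1 : x ^ (4 : ℤ) = x ^ 4 := by norm_cast
  have e2 : x ^ (12 : ℤ) = x ^ 12 := by norm_cast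
  rw [e1, e2]
  field_simp

/-! ### Structure of invariant functions -/

lemma HasE.decr {N m : ℕ} [NeZero N] {p : PowerSeries ℂ} {f : ℍ → ℂ}
    (hf : HasE N (m + 1) p f) (h0 : p.coeff 0 = 0) : ∃ r, HasE N m r f := by
  set r : PowerSeries ℂ := PowerSeries.mk fun i => p.coeff (i + 1) with hr
  have hpr : p = PowerSeries.X * r := by
    ext i
    cases i with
    | zero => simp [h0]
    | succ i => simp [hr, PowerSeries.coeff_succ_X_mul]
  have hrc : Conv r := by
    intro z hz
    by_cases hz0 : z = 0
    · refine summable_of_ne_finset_zero (s := {0}) fun b hb => ?_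
      simp at hb
      simp [hz0, hb]
    · have h1 := ((summable_nat_add_iff 1).2 (hf.1.2 z hz)).mul_left ‖z⁻¹‖
      refine h1.congr fun k => ?_
      rw [← norm_mul]
      congr 1
      simp only [hr, PowerSeries.coeff_mk]
      rw [pow_succ]
      field_simp
  refine ⟨r, ⟨fun k => by simpa [hr] using hf.1.1 (k + 1), hrc⟩, fun τ => ?_⟩
  have h1 := hf.2 τ
  rw [hpr, ev_mul good_X.2 hrc (norm_qq N τ), ev_X, pow_succ', mul_assoc] at h1
  exact mul_left_cancel₀ (qq_ne_zero N τ) h1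

lemma qq_pow (N : ℕ) [NeZero N] (τ : ℍ) : qq 1 τ = qq N τ ^ N := by
  have : (N : ℂ) ≠ 0 := by exact_mod_cast NeZero.ne N
  simp only [qq, Function.Periodic.qParam, ← Complex.exp_nat_mul]
  congr 1
  push_cast
  field_simp

lemma hasE_level {m : ℕ} {p : PowerSeries ℂ} {f : ℍ → ℂ} (hf : HasE 1 m p f) (N : ℕ) [NeZero N] :
    HasE N (N * m) (subst 1 N p) f := by
  have := hf.comp (N := N) id (ζ := 1) (k := N) (Nat.pos_of_neZero N) (by simp) (one_mem _)
    (by simpa using one_mem AI) (fun τ => by simpa using qq_pow N τ)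
  simpa using this

lemma structure_jj {N : ℕ} [NeZero N] (m : ℕ) : ∀ (p : PowerSeries ℂ) (f : ℍ → ℂ),
    HasE N m p f → Inv f → ∃ P : Polynomial AI, P.natDegree * N ≤ m ∧
      (∀ τ, f τ = Polynomial.aeval (jj τ) P) ∧
      (p.coeff 0 ≠ 0 → N ∣ m ∧ (P.coeff (m / N) : ℂ) = p.coeff 0) := by
  induction m with
  | zero =>
    intro p f hf hi
    refine ⟨Polynomial.C ⟨p.coeff 0, hf.1.1 0⟩, by simp, fun τ => ?_, fun _ => by simp⟩
    rw [const_of_hasE hf hi, Polynomial.aeval_C]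
    rfl
  | succ m ih =>
    intro p f hf hi
    by_cases h0 : p.coeff 0 = 0
    · obtain ⟨r, hr⟩ := hf.decr h0
      obtain ⟨P, h1, h2, -⟩ := ih r f hr hi
      exact ⟨P, by omega, h2, fun h => (h h0).elim⟩
    · obtain ⟨d, hd⟩ := dvd_of_leading hf hi h0
      obtain ⟨s, hs, hs0⟩ := hasE_jj
      have h1 := (hasE_level hs N).pow d
      have h2 := (hasE_const (N := N) (neg_mem (hf.1.1 0))).mul h1
      have e : 0 + d * (N * 1) = m + 1 := by rw [hd]; ring
      rw [e] at h2
      have h3 := hf.add_same h2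
      obtain ⟨r, hr⟩ := h3.decr (by
        rw [map_add, c0_mul, c0_pow, coeff_zero_subst, hs0]; simp)
      obtain ⟨P, hP1, hP2, -⟩ := ih r _ hr (fun γ τ => by
        rw [hi, inv_jj])
      have hN : 0 < N := Nat.pos_of_neZero N
      have hlt : P.natDegree < d := by
        by_contra! hcon
        have := Nat.mul_le_mul_right N hcon
        rw [mul_comm d N, ← hd] at this
        omega
      refine ⟨Polynomial.C ⟨p.coeff 0, hf.1.1 0⟩ * Polynomial.X ^ d + P, ?_, fun τ => ?_, fun _ => ?_⟩
      · have : (Polynomial.C (⟨p.coeff 0, hf.1.1 0⟩ : AI) * Polynomial.X ^ d + P).natDegree ≤ d :=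
          (Polynomial.natDegree_add_le _ _).trans
            (max_le (Polynomial.natDegree_C_mul_X_pow_le _ _) hlt.le)
        calc _ ≤ d * N := Nat.mul_le_mul_right N this
          _ = m + 1 := by rw [hd]; ring
      · have h4 := hP2 τ
        simp only [map_add, map_mul, Polynomial.aeval_C, map_pow, Polynomial.aeval_X, ← h4]
        change f τ = p.coeff 0 * jj τ ^ d + (f τ + -p.coeff 0 * jj τ ^ d)
        ring
      · refine ⟨⟨d, hd⟩, ?_⟩
        have : (m + 1) / N = d := by rw [hd, Nat.mul_div_cancel_left _ hN]
        rw [this]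
        simp [Polynomial.coeff_eq_zero_of_natDegree_lt hlt]


end Part3

section Part4





/-! ### Integrality helpers -/

lemma mem_AI_of_isIntegral {x : ℂ} (h : IsIntegral AI x) : x ∈ AI :=
  (mem_integralClosure_iff ℤ ℂ).2 (isIntegral_trans x h)

lemma aeval_mem_AI {x : ℂ} (hx : x ∈ AI) (P : Polynomial AI) : Polynomial.aeval x P ∈ AI := by
  have := Polynomial.aeval_algebraMap_apply ℂ (⟨x, hx⟩ : AI) P
  change Polynomial.aeval x P = _ at this
  rw [this]
  exact Subtype.mem _

lemma mem_AI_of_monic {x : ℂ} {f : Polynomial ℂ} (hf : f.Monic) (hc : ∀ k, f.coeff k ∈ AI)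
    (hx : f.eval x = 0) : x ∈ AI := by
  refine mem_AI_of_isIntegral ?_
  have h1 : f ∈ Polynomial.lifts (algebraMap AI ℂ) := by
    rw [Polynomial.lifts_iff_coeff_lifts]
    intro k
    exact ⟨⟨_, hc k⟩, rfl⟩
  obtain ⟨g, hg, -, hg2⟩ := Polynomial.lifts_and_natDegree_eq_and_monic h1 hf
  refine ⟨g, hg2, ?_⟩
  rw [Polynomial.eval₂_eq_eval_map, hg, hx]

lemma Inv.mem_AI {N : ℕ} [NeZero N] {f : ℍ → ℂ} (hf : f ∈ Ls N) (hi : Inv f) {τ : ℍ}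
    (hj : jj τ ∈ AI) : f τ ∈ AI := by
  obtain ⟨m, p, h⟩ := hf
  obtain ⟨P, -, h2, -⟩ := structure_jj m p f h hi
  rw [h2]
  exact aeval_mem_AI hj P

lemma family_mem_AI {N : ℕ} [NeZero N] {ι : Type*} [Fintype ι] (F : ι → ℍ → ℂ)
    (hF : ∀ i, F i ∈ Ls N)
    (hperm : ∀ γ : SLZ, ∃ σ : Equiv.Perm ι, ∀ i τ, F i (γ • τ) = F (σ i) τ)
    {τ : ℍ} (hj : jj τ ∈ AI) (i : ι) : F i τ ∈ AI := by
  set Pτ : ℍ → Polynomial ℂ := fun τ => ∏ i, (Polynomial.X - Polynomial.C (F i τ)) with hP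
  have hinv : ∀ (γ : SLZ) (τ : ℍ), Pτ (γ • τ) = Pτ τ := by
    intro γ τ
    obtain ⟨σ, hσ⟩ := hperm γ
    simp only [hP, hσ]
    exact Equiv.prod_comp σ fun i => (Polynomial.X - Polynomial.C (F i τ))
  set PL : Polynomial (Ls N) := ∏ i, (Polynomial.X - Polynomial.C (⟨F i, hF i⟩ : Ls N)) with hPL
  have hcoef : ∀ k, (fun τ => (Pτ τ).coeff k) ∈ Ls N := by
    intro k
    have : (fun τ => (Pτ τ).coeff k) = ((PL.coeff k : Ls N) : ℍ → ℂ) := by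
      ext τ
      have h1 : Pτ τ = PL.map ((Pi.evalRingHom (fun _ : ℍ => ℂ) τ).comp (Ls N).subtype) := by
        simp [hP, hPL, Polynomial.map_prod]
      rw [h1, Polynomial.coeff_map]
      rfl
    rw [this]
    exact Subtype.mem _
  refine mem_AI_of_monic (f := Pτ τ) (Polynomial.monic_prod_of_monic _ _ fun i _ =>
    Polynomial.monic_X_sub_C _) (fun k => ?_) ?_
  · exact Inv.mem_AI (hcoef k) (fun γ τ => congrArg (fun P => P.coeff k) (hinv γ τ)) hj
  · simp only [hP, Polynomial.eval_prod]
    exact Finset.prod_eq_zero (Finset.mem_univ i) (by simp)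

/-! ### Integral matrices of determinant `n` -/

/-- Integral matrices of determinant `n`. -/
abbrev D (n : ℕ) := FixedDetMatrix (Fin 2) ℤ (n : ℤ)

lemma exists_reps {n : ℕ} [NeZero n] (A : D n) :
    ∃ (γ : SLZ) (B : D n), B ∈ FixedDetMatrices.reps (n : ℤ) ∧ A = γ • B := by
  have hn : (n : ℤ) ≠ 0 := by exact_mod_cast NeZero.ne n
  refine FixedDetMatrices.induction_on (C := fun A => ∃ (γ : SLZ) (B : D n),
    B ∈ FixedDetMatrices.reps (n : ℤ) ∧ A = γ • B) hn ?_ ?_ ?_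
  · intro A h1 h2 h3 h4
    exact ⟨1, A, ⟨h1, h2, h3, h4⟩, (one_smul _ _).symm⟩
  · rintro A ⟨γ, B, hB, rfl⟩
    exact ⟨ModularGroup.S * γ, B, hB, (mul_smul _ _ _).symm⟩
  · rintro A ⟨γ, B, hB, rfl⟩
    exact ⟨ModularGroup.T * γ, B, hB, (mul_smul _ _ _).symm⟩

/-- Orbits of integral matrices of determinant `n` under left multiplication. -/
abbrev Orb (n : ℕ) := MulAction.orbitRel.Quotient SLZ (D n)

instance finite_Orb (n : ℕ) [NeZero n] : Finite (Orb n) := by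
  refine Finite.of_surjective
    (fun B : FixedDetMatrices.reps (n : ℤ) => (Quotient.mk'' B.1 : Orb n)) ?_
  intro c
  induction c using Quotient.inductionOn' with
  | h A =>
    obtain ⟨γ, B, hB, rfl⟩ := exists_reps A
    refine ⟨⟨B, hB⟩, ?_⟩
    rw [Quotient.eq'', MulAction.orbitRel_apply, MulAction.mem_orbit_iff]
    exact ⟨γ⁻¹, by simp⟩

/-- right multiplication -/
def rmul {n : ℕ} (A : D n) (γ : SLZ) : D n := ⟨A.1 * γ.1, by
  rw [Matrix.det_mul, A.2, γ.2, mul_one]⟩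

lemma rmul_smul {n : ℕ} (A : D n) (γ δ : SLZ) : rmul (δ • A) γ = δ • rmul A γ := by
  apply FixedDetMatrices.ext'
  exact Matrix.mul_assoc _ _ _

lemma rmul_rmul {n : ℕ} (A : D n) (γ δ : SLZ) : rmul (rmul A γ) δ = rmul A (γ * δ) := by
  apply FixedDetMatrices.ext'
  simp [rmul, Matrix.mul_assoc]

lemma rmul_one {n : ℕ} (A : D n) : rmul A 1 = A := by
  apply FixedDetMatrices.ext'
  simp [rmul]

/-- right multiplication on orbits -/
def rOrb {n : ℕ} (γ : SLZ) : Orb n → Orb n :=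
  Quotient.map' (fun A => rmul A γ) (by
    intro A B h
    rw [MulAction.orbitRel_apply, MulAction.mem_orbit_iff] at h ⊢
    obtain ⟨δ, rfl⟩ := h
    exact ⟨δ, (rmul_smul _ _ _).symm⟩)

lemma rOrb_rOrb {n : ℕ} (γ δ : SLZ) (c : Orb n) : rOrb δ (rOrb γ c) = rOrb (γ * δ) c := by
  induction c using Quotient.inductionOn' with
  | h A => exact congrArg (Quotient.mk'' : D n → Orb n) (rmul_rmul A γ δ)

lemma rOrb_one {n : ℕ} (c : Orb n) : rOrb 1 c = c := by
  induction c using Quotient.inductionOn' with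
  | h A => exact congrArg (Quotient.mk'' : D n → Orb n) (rmul_one A)

/-- right multiplication as a permutation of the orbits -/
def rPerm {n : ℕ} (γ : SLZ) : Equiv.Perm (Orb n) where
  toFun := rOrb γ
  invFun := rOrb γ⁻¹
  left_inv c := by rw [rOrb_rOrb, mul_inv_cancel, rOrb_one]
  right_inv c := by rw [rOrb_rOrb, inv_mul_cancel, rOrb_one]

/-- A family of functions indexed by matrices, equivariant. -/
structure Equi {n : ℕ} (Φ : D n → ℍ → ℂ) : Prop where
  left : ∀ (γ : SLZ) (A : D n) (τ : ℍ), Φ (γ • A) τ = Φ A τ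
  right : ∀ (γ : SLZ) (A : D n) (τ : ℍ), Φ A (γ • τ) = Φ (rmul A γ) τ

/-- descent to orbits -/
def Equi.lift {n : ℕ} {Φ : D n → ℍ → ℂ} (h : Equi Φ) (c : Orb n) : ℍ → ℂ :=
  Quotient.liftOn' c Φ (by
    intro A B hAB
    rw [MulAction.orbitRel_apply, MulAction.mem_orbit_iff] at hAB
    obtain ⟨δ, rfl⟩ := hAB
    ext τ
    exact h.left δ B τ)

lemma Equi.lift_perm {n : ℕ} {Φ : D n → ℍ → ℂ} (h : Equi Φ) (γ : SLZ) (c : Orb n) (τ : ℍ) :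
    h.lift c (γ • τ) = h.lift (rPerm γ c) τ := by
  induction c using Quotient.inductionOn' with
  | h A => exact h.right γ A τ

lemma Equi.of_reps {n : ℕ} [NeZero n] {Φ : D n → ℍ → ℂ} (h : Equi Φ) (S : (ℍ → ℂ) → Prop)
    (hS : ∀ B ∈ FixedDetMatrices.reps (n : ℤ), S (Φ B)) (c : Orb n) : S (h.lift c) := by
  induction c using Quotient.inductionOn' with
  | h A =>
    obtain ⟨γ, B, hB, rfl⟩ := exists_reps A
    have : h.lift (Quotient.mk'' (γ • B)) = Φ B := by
      ext τ
      exact h.left γ B τ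
    rw [this]
    exact hS B hB

lemma Equi.mem_AI {n : ℕ} [NeZero n] {Φ : D n → ℍ → ℂ} (h : Equi Φ)
    (hS : ∀ B ∈ FixedDetMatrices.reps (n : ℤ), Φ B ∈ Ls n) {τ : ℍ} (hj : jj τ ∈ AI) (A : D n) :
    Φ A τ ∈ AI := by
  have := Fintype.ofFinite (Orb n)
  exact family_mem_AI h.lift (h.of_reps (fun f => f ∈ Ls n) hS)
    (fun γ => ⟨rPerm γ, fun c τ => h.lift_perm γ c τ⟩) hj (Quotient.mk'' A)


end Part4

section Part5





/-! ### The action of integral matrices on the upper half plane -/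

lemma det_toGL {n : ℕ} (A : D n) : (A.1.map (Int.cast : ℤ → ℝ)).det = n := by
  have h := (Int.castRingHom ℝ).map_det A.1
  rw [A.2] at h
  simpa using h.symm

/-- The real invertible matrix attached to an integral one. -/
noncomputable def toGL {n : ℕ} [NeZero n] (A : D n) : GL (Fin 2) ℝ :=
  Matrix.GeneralLinearGroup.mkOfDetNeZero (A.1.map (Int.cast : ℤ → ℝ)) (by
    rw [det_toGL]; exact_mod_cast NeZero.ne n)

lemma toGL_coe {n : ℕ} [NeZero n] (A : D n) :
    (toGL A : Matrix (Fin 2) (Fin 2) ℝ) = A.1.map (Int.cast : ℤ → ℝ) := rfl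

lemma toGL_det {n : ℕ} [NeZero n] (A : D n) : (toGL A).det.val = n := det_toGL A

lemma toGL_det_pos {n : ℕ} [NeZero n] (A : D n) : 0 < (toGL A).det.val := by
  rw [toGL_det]; exact_mod_cast Nat.pos_of_neZero n

lemma toGL_smul {n : ℕ} [NeZero n] (γ : SLZ) (A : D n) :
    toGL (γ • A) = Matrix.SpecialLinearGroup.mapGL ℝ γ * toGL A := by
  apply Units.ext
  rw [Units.val_mul, toGL_coe, toGL_coe, FixedDetMatrices.smul_coe]
  ext i j
  simp [Matrix.mul_apply]

lemma toGL_rmul {n : ℕ} [NeZero n] (γ : SLZ) (A : D n) :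
    toGL (rmul A γ) = toGL A * Matrix.SpecialLinearGroup.mapGL ℝ γ := by
  apply Units.ext
  rw [Units.val_mul, toGL_coe, toGL_coe]
  ext i j
  simp [Matrix.mul_apply, rmul]

/-- The action. -/
noncomputable def act {n : ℕ} [NeZero n] (A : D n) (τ : ℍ) : ℍ := toGL A • τ

lemma act_smul {n : ℕ} [NeZero n] (γ : SLZ) (A : D n) (τ : ℍ) :
    act (γ • A) τ = γ • act A τ := by
  rw [act, toGL_smul, mul_smul]; rfl

lemma act_rmul {n : ℕ} [NeZero n] (γ : SLZ) (A : D n) (τ : ℍ) :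
    act (rmul A γ) τ = act A (γ • τ) := by
  rw [act, toGL_rmul, mul_smul]; rfl

lemma coe_act {n : ℕ} [NeZero n] (A : D n) (τ : ℍ) :
    (act A τ : ℂ) = (A.1 0 0 * τ + A.1 0 1) / (A.1 1 0 * τ + A.1 1 1) := by
  rw [act, UpperHalfPlane.coe_smul_of_det_pos (toGL_det_pos A), UpperHalfPlane.num,
    UpperHalfPlane.denom, toGL_coe]
  simp

/-- The function `j - j ∘ A`. -/
noncomputable def jdiff {n : ℕ} [NeZero n] (A : D n) (τ : ℍ) : ℂ := jj τ + -1 * jj (act A τ)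

lemma equi_jdiff {n : ℕ} [NeZero n] : Equi (jdiff (n := n)) where
  left γ A τ := by rw [jdiff, jdiff, act_smul, inv_jj]
  right γ A τ := by rw [jdiff, jdiff, act_rmul, inv_jj]

open scoped ModularForm in
/-- The quotient of discriminants attached to a matrix. -/
noncomputable def phi {n : ℕ} [NeZero n] (A : D n) (τ : ℍ) : ℂ :=
  n * (ModularForm.discriminant ∣[(12 : ℤ)] toGL A) τ * (ModularForm.discriminant τ)⁻¹

open scoped ModularForm in
lemma slash_SL_apply' (f : ℍ → ℂ) (γ : SLZ) (τ : ℍ) :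
    f (γ • τ) = (f ∣[(12 : ℤ)] γ) τ * UpperHalfPlane.denom γ τ ^ (12 : ℤ) := by
  rw [ModularForm.SL_slash_apply, zpow_neg, inv_mul_cancel_right₀]
  exact zpow_ne_zero _ (UpperHalfPlane.denom_ne_zero _ _)

open scoped ModularForm in
lemma equi_phi {n : ℕ} [NeZero n] : Equi (phi (n := n)) where
  left γ A τ := by
    rw [phi, phi, toGL_smul, SlashAction.slash_mul]
    have := disc_slash γ
    rw [ModularForm.SL_slash] at this
    erw [this]
  right γ A τ := by
    rw [phi, phi, toGL_rmul, SlashAction.slash_mul,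
      slash_SL_apply' (ModularForm.discriminant ∣[(12 : ℤ)] toGL A) γ τ,
      slash_SL_apply' ModularForm.discriminant γ τ, disc_slash]
    have h0 : UpperHalfPlane.denom γ τ ^ (12 : ℤ) ≠ 0 :=
      zpow_ne_zero _ (UpperHalfPlane.denom_ne_zero _ _)
    change _ = n * ((ModularForm.discriminant ∣[(12 : ℤ)] toGL A) ∣[(12 : ℤ)] γ) τ * _
    generalize UpperHalfPlane.denom γ τ ^ (12 : ℤ) = x at h0
    rw [mul_inv]
    field_simp

lemma phi_of_upper {n : ℕ} [NeZero n] {A : D n} (h : A.1 1 0 = 0) (τ : ℍ) :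
    phi A τ = (A.1 0 0 : ℂ) ^ 12 * ModularForm.discriminant (act A τ) *
      (ModularForm.discriminant τ)⁻¹ := by
  have hdet : (A.1 0 0 : ℂ) * A.1 1 1 = n := by
    have := A.2
    rw [Matrix.det_fin_two, h] at this
    have h2 : A.1 0 0 * A.1 1 1 = n := by linarith
    exact_mod_cast h2
  have hn : (n : ℂ) ≠ 0 := by exact_mod_cast NeZero.ne n
  have hd : (A.1 1 1 : ℂ) ≠ 0 := by
    intro h0
    rw [h0, mul_zero] at hdet
    exact hn hdet.symm
  rw [phi, ModularForm.slash_apply, UpperHalfPlane.σ, if_pos (toGL_det_pos A), toGL_det,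
    UpperHalfPlane.denom, toGL_coe]
  simp only [Matrix.map_apply, h]
  change n * (ModularForm.discriminant (act A τ) * _ * _) * _ = _
  have e1 : (((|(n : ℝ)| : ℝ) : ℂ)) ^ ((12 : ℤ) - 1) = (n : ℂ) ^ 11 := by
    rw [abs_of_nonneg (Nat.cast_nonneg n)]
    norm_num
  have e2 : (((0 : ℤ) : ℝ) : ℂ) * (τ : ℂ) + ((A.1 1 1 : ℝ) : ℂ) = A.1 1 1 := by
    push_cast; ring
  rw [e1, e2, ← hdet, zpow_neg]
  have e3 : (A.1 1 1 : ℂ) ^ (12 : ℤ) = (A.1 1 1 : ℂ) ^ 12 := by norm_cast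
  rw [e3]
  field_simp

/-! ### Expansions for representatives -/

lemma reps_facts {n : ℕ} [NeZero n] {A : D n} (hA : A ∈ FixedDetMatrices.reps (n : ℤ)) :
    ∃ a d : ℕ, 0 < a ∧ 0 < d ∧ A.1 0 0 = a ∧ A.1 1 1 = d ∧ A.1 1 0 = 0 ∧ a * d = n := by
  obtain ⟨h1, h2, h3, h4⟩ := hA
  have hdet := A.2
  rw [Matrix.det_fin_two, h1] at hdet
  have hn : (0 : ℤ) < n := by exact_mod_cast Nat.pos_of_neZero n
  have hd : 0 < A.1 1 1 := by
    by_contra! hcon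
    nlinarith
  obtain ⟨a, ha⟩ := Int.eq_ofNat_of_zero_le h2.le
  obtain ⟨d, hd'⟩ := Int.eq_ofNat_of_zero_le hd.le
  refine ⟨a, d, by omega, by omega, ha, hd', h1, ?_⟩
  rw [ha, hd'] at hdet
  zify
  linarith

lemma rep_comp {n : ℕ} [NeZero n] {A : D n} (hA : A ∈ FixedDetMatrices.reps (n : ℤ)) :
    ∃ (a : ℕ) (ζ : ℂ), 0 < a ∧ A.1 0 0 = a ∧ A.1 1 0 = 0 ∧ ‖ζ‖ = 1 ∧ ζ ∈ AI ∧ ζ⁻¹ ∈ AI ∧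
      ∀ τ, qq 1 (act A τ) = ζ * qq n τ ^ (a ^ 2) := by
  obtain ⟨a, d, ha, hd, h00, h11, h10, had⟩ := reps_facts hA
  set ζ := Complex.exp (2 * Real.pi * Complex.I * (A.1 0 1) / d) with hζ
  have hdc : (d : ℂ) ≠ 0 := by exact_mod_cast hd.ne'
  have hac : (a : ℂ) ≠ 0 := by exact_mod_cast ha.ne'
  have hζd : ζ ^ d = 1 := by
    rw [hζ, ← Complex.exp_nat_mul, Complex.exp_eq_one_iff]
    refine ⟨A.1 0 1, ?_⟩
    field_simp
  refine ⟨a, ζ, ha, h00, h10, ?_, ?_, ?_, fun τ => ?_⟩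
  · exact Complex.norm_eq_one_of_pow_eq_one hζd hd.ne'
  · refine IsIntegral.of_pow hd ?_
    rw [hζd]; exact isIntegral_one
  · refine IsIntegral.of_pow hd ?_
    rw [inv_pow, hζd, inv_one]; exact isIntegral_one
  · simp only [qq, Function.Periodic.qParam, coe_act, h00, h10, h11, ← Complex.exp_nat_mul, hζ,
      ← Complex.exp_add]
    congr 1
    have hnc : (n : ℂ) = a * d := by rw [← had]; push_cast; ring
    push_cast
    rw [hnc, zero_mul, zero_add]
    field_simp
    ring

lemma phi_mem_Ls {n : ℕ} [NeZero n] {A : D n} (hA : A ∈ FixedDetMatrices.reps (n : ℤ)) :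
    phi A ∈ Ls n := by
  obtain ⟨a, ζ, ha, h00, h10, h1, h2, h3, h4⟩ := rep_comp hA
  obtain ⟨p, hp⟩ := hasE_disc
  obtain ⟨r, hr, -⟩ := hasE_disc_inv
  have e1 := hp.comp (N := n) (act A) (k := a ^ 2) (by positivity) h1 h2 h3 h4
  have e2 := hasE_level hr n
  refine ⟨_, _, (((hasE_const (N := n) (a := (a : ℂ) ^ 12) (pow_mem (natCast_mem _ a) 12)).mul
    e1).mul e2).congr fun τ => ?_⟩
  rw [phi_of_upper h10, h00]
  push_cast
  rfl

lemma jdiff_hasE {n : ℕ} [NeZero n] (hn : ¬ IsSquare n) {A : D n}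
    (hA : A ∈ FixedDetMatrices.reps (n : ℤ)) :
    ∃ m p, HasE n m p (jdiff A) ∧ p.coeff 0 ≠ 0 ∧ (p.coeff 0)⁻¹ ∈ AI := by
  obtain ⟨a, ζ, ha, h00, h10, h1, h2, h3, h4⟩ := rep_comp hA
  have hζ0 : ζ ≠ 0 := by rintro rfl; simp at h1
  obtain ⟨p, hp, hp0⟩ := hasE_jj
  have e1 := hp.comp (N := n) (act A) (k := a ^ 2) (by positivity) h1 h2 h3 h4
  have e2 := hasE_level hp n
  have e3 := (hasE_const (N := n) (neg_mem (one_mem AI))).mul e1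
  rw [zero_add, mul_one] at e3
  rw [mul_one] at e2
  rcases lt_trichotomy n (a ^ 2) with h | h | h
  · obtain ⟨k, hk⟩ := Nat.exists_eq_add_of_lt h
    have e4 := e2.shift (k + 1)
    rw [← add_assoc, ← hk] at e4
    refine ⟨_, _, e4.add_same e3, ?_⟩
    rw [map_add, c0_mul, c0_pow, c0_mul, c0_mul, coeff_zero_subst, coeff_zero_subst, hp0]
    simp [hζ0, h2, neg_mem_iff]
  · exact (hn ⟨a, by rw [h, sq]⟩).elim
  · obtain ⟨k, hk⟩ := Nat.exists_eq_add_of_lt h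
    have e4 := e3.shift (k + 1)
    rw [← add_assoc, ← hk] at e4
    refine ⟨_, _, e2.add_same e4, ?_⟩
    rw [map_add, c0_mul, c0_pow, c0_mul, c0_mul, coeff_zero_subst, coeff_zero_subst, hp0]
    simp [one_mem]

/-! ### Integrality of `j` at fixed points -/

lemma jj_mem_AI_of_fixed {n : ℕ} [NeZero n] (hn : ¬ IsSquare n) (A : D n) {τ : ℍ}
    (hτ : act A τ = τ) : jj τ ∈ AI := by
  have := Fintype.ofFinite (Orb n)
  have hE := equi_jdiff (n := n)
  have h1 := hE.of_reps (fun f => ∃ m p, HasE n m p f ∧ p.coeff 0 ≠ 0 ∧ (p.coeff 0)⁻¹ ∈ AI)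
    (fun B hB => jdiff_hasE hn hB)
  choose m p h2 h3 h4 using h1
  have h5 := hasE_prod Finset.univ m p hE.lift fun i _ => h2 i
  have hinv : Inv (fun τ => ∏ c, hE.lift c τ) := by
    intro γ τ
    simp only [hE.lift_perm γ]
    exact Equiv.prod_comp (rPerm γ) fun c => hE.lift c τ
  obtain ⟨P, hP1, hP2, hP3⟩ := structure_jj _ _ _ h5 hinv
  have hc : (∏ c, p c).coeff 0 = ∏ c, (p c).coeff 0 := by
    simpa using map_prod (PowerSeries.constantCoeff (R := ℂ)) p Finset.univ
  have hc0 : (∏ c, p c).coeff 0 ≠ 0 := by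
    rw [hc]; exact Finset.prod_ne_zero_iff.2 fun c _ => h3 c
  have hcinv : ((∏ c, p c).coeff 0)⁻¹ ∈ AI := by
    rw [hc, ← Finset.prod_inv_distrib]
    exact prod_mem fun c _ => h4 c
  obtain ⟨hdvd, hlead⟩ := hP3 hc0
  set u : AI := ⟨_, hcinv⟩ with hu
  have hzero : Polynomial.aeval (jj τ) P = 0 := by
    rw [← hP2 τ]
    refine Finset.prod_eq_zero (Finset.mem_univ (Quotient.mk'' A : Orb n)) ?_
    change jdiff A τ = 0
    rw [jdiff, hτ]; ring
  refine mem_AI_of_isIntegral ⟨Polynomial.C u * P, ?_, ?_⟩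
  · refine Polynomial.monic_of_natDegree_le_of_coeff_eq_one ((∑ c, m c) / n) ?_ ?_
    · refine (Polynomial.natDegree_C_mul_le _ _).trans ?_
      exact (Nat.le_div_iff_mul_le (Nat.pos_of_neZero n)).2 hP1
    · rw [Polynomial.coeff_C_mul]
      apply Subtype.ext
      push_cast
      rw [hlead, hu]
      exact inv_mul_cancel₀ hc0
  · rw [← Polynomial.aeval_def, map_mul, hzero, mul_zero]


end Part5

section Part6




/-! ### Imaginary quadratic points -/

/-- An imaginary quadratic point. -/
def CM (τ : ℍ) : Prop :=
  ∃ a b c : ℤ, a ≠ 0 ∧ (a : ℂ) * (τ : ℂ) ^ 2 + (b : ℂ) * (τ : ℂ) + (c : ℂ) = 0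

lemma disc_neg {τ : ℍ} {a b c : ℤ} (ha : a ≠ 0)
    (h : (a : ℂ) * (τ : ℂ) ^ 2 + (b : ℂ) * (τ : ℂ) + (c : ℂ) = 0) : b ^ 2 - 4 * a * c < 0 := by
  have hy := τ.im_pos
  have hτ : (τ : ℂ) = τ.re + τ.im * Complex.I := by
    apply Complex.ext <;> simp
  have har : (a : ℝ) ≠ 0 := by exact_mod_cast ha
  rw [hτ] at h
  have h1 := congrArg Complex.re h
  have h2 := congrArg Complex.im h
  simp [pow_two] at h1 h2
  generalize τ.re = x at *
  generalize τ.im = y at *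
  have h3 : 2 * (a : ℝ) * x + b = 0 := by
    have : y * (2 * (a : ℝ) * x + b) = 0 := by linarith
    exact (mul_eq_zero.mp this).resolve_left hy.ne'
  have h4 : ((b ^ 2 - 4 * a * c : ℤ) : ℝ) = - (2 * a * y) ^ 2 := by
    push_cast
    have hb : (b : ℝ) = - (2 * a * x) := by linarith
    rw [hb] at h1 ⊢
    linear_combination (-4 * (a : ℝ)) * h1
  have h5 : ((b ^ 2 - 4 * a * c : ℤ) : ℝ) < 0 := by
    rw [h4]
    have : 2 * (a : ℝ) * y ≠ 0 := by positivity
    have := sq_pos_of_ne_zero this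
    linarith
  exact_mod_cast h5

lemma den_ne {a : ℤ} (ha : a ≠ 0) (x : ℤ) (τ : ℍ) : (a : ℂ) * τ + x ≠ 0 := by
  intro h
  have h2 := congrArg Complex.im h
  simp at h2
  exact h2.elim ha τ.im_pos.ne'

lemma CM.jj_mem {τ : ℍ} (h : CM τ) : jj τ ∈ AI := by
  obtain ⟨a, b, c, ha, h⟩ := h
  have hd := disc_neg ha h
  obtain ⟨t, ht⟩ : ∃ t : ℕ, (t : ℤ) = 4 * a * c - b ^ 2 :=
    ⟨(4 * a * c - b ^ 2).toNat, by omega⟩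
  have ht0 : 0 < t := by omega
  have : NeZero (t * t + t) := ⟨by positivity⟩
  have hns : ¬ IsSquare (t * t + t) := by
    rintro ⟨r, hr⟩
    have h1 : t < r := by
      by_contra hc
      push Not at hc
      have := Nat.mul_le_mul hc hc
      omega
    have := Nat.mul_le_mul h1 h1
    simp only [Nat.succ_eq_add_one] at this
    nlinarith
  let A : D (t * t + t) := ⟨!![(t : ℤ) - b, -2 * c; 2 * a, t + b], by
    rw [Matrix.det_fin_two_of]
    push_cast
    linear_combination (-1) * ht⟩
  refine jj_mem_AI_of_fixed hns A (τ := τ) ?_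
  apply UpperHalfPlane.ext
  rw [coe_act]
  have hA00 : A.1 0 0 = (t : ℤ) - b := rfl
  have hA01 : A.1 0 1 = -2 * c := rfl
  have hA10 : A.1 1 0 = 2 * a := rfl
  have hA11 : A.1 1 1 = (t : ℤ) + b := rfl
  have hne := den_ne (a := 2 * a) (by positivity) (t + b) τ
  rw [hA00, hA01, hA10, hA11, div_eq_iff hne]
  push_cast
  linear_combination (-2) * h

/-- The point `k τ`. -/
noncomputable def mulp (k : ℕ) [NeZero k] (τ : ℍ) : ℍ :=
  ⟨k * τ, by
    have : 0 < k := Nat.pos_of_neZero k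
    have := τ.im_pos
    simp
    positivity⟩

lemma coe_mulp (k : ℕ) [NeZero k] (τ : ℍ) : (mulp k τ : ℂ) = k * τ := rfl

lemma CM.mulp {τ : ℍ} (h : CM τ) (k : ℕ) [NeZero k] : CM (mulp k τ) := by
  obtain ⟨a, b, c, ha, h⟩ := h
  refine ⟨a, k * b, k ^ 2 * c, ha, ?_⟩
  rw [coe_mulp]
  push_cast
  linear_combination (k : ℂ) ^ 2 * h

lemma CM.up {τ : ℍ} (h : CM τ) (k : ℕ) [NeZero k] :
    (k : ℂ) ^ 12 * (ModularForm.discriminant (EtaCM.mulp k τ) / ModularForm.discriminant τ) ∈ AI := by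
  let A : D k := ⟨!![(k : ℤ), 0; 0, 1], by rw [Matrix.det_fin_two_of]; ring⟩
  have h1 := equi_phi.mem_AI (fun B hB => phi_mem_Ls hB) h.jj_mem A
  rw [phi_of_upper (A := A) rfl] at h1
  have h2 : act A τ = EtaCM.mulp k τ := by
    apply UpperHalfPlane.ext
    rw [coe_act, coe_mulp]
    have hA00 : A.1 0 0 = (k : ℤ) := rfl
    have hA01 : A.1 0 1 = 0 := rfl
    have hA10 : A.1 1 0 = 0 := rfl
    have hA11 : A.1 1 1 = 1 := rfl
    rw [hA00, hA01, hA10, hA11]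
    simp
  rw [h2] at h1
  have hA00 : A.1 0 0 = (k : ℤ) := rfl
  rw [hA00, Int.cast_natCast, mul_assoc, ← div_eq_mul_inv] at h1
  exact h1

lemma CM.down {τ : ℍ} (h : CM τ) (k : ℕ) [NeZero k] :
    ModularForm.discriminant τ / ModularForm.discriminant (EtaCM.mulp k τ) ∈ AI := by
  let A : D k := ⟨!![1, 0; 0, (k : ℤ)], by rw [Matrix.det_fin_two_of]; ring⟩
  have h1 := equi_phi.mem_AI (fun B hB => phi_mem_Ls hB) (h.mulp k).jj_mem A
  rw [phi_of_upper (A := A) rfl] at h1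
  have h2 : act A (EtaCM.mulp k τ) = τ := by
    apply UpperHalfPlane.ext
    rw [coe_act, coe_mulp]
    have hA00 : A.1 0 0 = 1 := rfl
    have hA01 : A.1 0 1 = 0 := rfl
    have hA10 : A.1 1 0 = 0 := rfl
    have hA11 : A.1 1 1 = (k : ℤ) := rfl
    rw [hA00, hA01, hA10, hA11]
    have : (k : ℂ) ≠ 0 := NeZero.ne _
    simp
    field_simp
  rw [h2] at h1
  have hA00 : A.1 0 0 = 1 := rfl
  rw [hA00, Int.cast_one, one_pow, one_mul, ← div_eq_mul_inv] at h1
  exact h1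

lemma mulp_mulp (k l m : ℕ) [NeZero k] [NeZero l] [NeZero m] (h : k * l = m) (τ : ℍ) :
    mulp k (mulp l τ) = mulp m τ := by
  apply UpperHalfPlane.ext
  rw [coe_mulp, coe_mulp, coe_mulp, ← h]
  push_cast
  ring

/-- The Euler product at `q ^ k`. -/
noncomputable def eul (z : ℂ) : ℂ := ∏' n : ℕ, (1 - z ^ (n + 1))

lemma disc_eul (τ : ℍ) : ModularForm.discriminant τ = qq 1 τ * eul (qq 1 τ) ^ 24 := by
  obtain ⟨p, -, -, hp⟩ := exists_euler
  rw [disc_eq hp, hp _ (norm_qq 1 τ), eul]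

lemma disc_mulp (k : ℕ) [NeZero k] (τ : ℍ) :
    ModularForm.discriminant (mulp k τ) = qq 1 τ ^ k * eul (qq 1 τ ^ k) ^ 24 := by
  have : qq 1 (mulp k τ) = qq 1 τ ^ k := by
    rw [qq_one, qq_one, Function.Periodic.qParam, Function.Periodic.qParam, ← Complex.exp_nat_mul,
      coe_mulp]
    congr 1
    ring
  rw [disc_eul, this]

lemma eul_ne (τ : ℍ) (k : ℕ) [NeZero k] : eul (qq 1 τ ^ k) ≠ 0 := by
  apply eulerProd_ne_zero
  rw [norm_pow]
  exact pow_lt_one₀ (norm_nonneg _) (norm_qq 1 τ) (NeZero.ne k)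

lemma bezout_mem {x : ℂ} (h2 : (2 : ℂ) ^ 12 * x ∈ AI) (h5 : (5 : ℂ) ^ 12 * x ∈ AI) : x ∈ AI := by
  have hc : IsCoprime ((2 : ℤ) ^ 12) (5 ^ 12) := by
    apply IsCoprime.pow
    rw [Int.isCoprime_iff_gcd_eq_one]
    rfl
  obtain ⟨u, v, huv⟩ := hc
  have huv' : (u : ℂ) * 2 ^ 12 + v * 5 ^ 12 = 1 := by exact_mod_cast huv
  have : x = u * (2 ^ 12 * x) + v * (5 ^ 12 * x) := by linear_combination (-x) * huv'
  rw [this]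
  exact add_mem (mul_mem (intCast_mem _ u) h2) (mul_mem (intCast_mem _ v) h5)

lemma main_aux {τ : ℍ} (h : CM τ) (x y s e1 e2 e5 e10 Q : ℂ) (hQ : Q = qq 1 τ)
    (he1 : e1 = eul (Q ^ 1)) (he2 : e2 = eul (Q ^ 2)) (he5 : e5 = eul (Q ^ 5))
    (he10 : e10 = eul (Q ^ 10)) (hs : s ^ 2 = Q)
    (hx : x = 1 / (e2 ^ 2 * e5 ^ 4 / (e1 ^ 4 * e10 ^ 2)))
    (hy : y = 1 / (s * (e1 * e10 ^ 2) / (e2 ^ 2 * e5))) :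
    IsIntegral ℤ x ∧ IsIntegral ℤ y := by
  have n1 : e1 ≠ 0 := by rw [he1, hQ]; exact eul_ne τ 1
  have n2 : e2 ≠ 0 := by rw [he2, hQ]; exact eul_ne τ 2
  have n5 : e5 ≠ 0 := by rw [he5, hQ]; exact eul_ne τ 5
  have n10 : e10 ≠ 0 := by rw [he10, hQ]; exact eul_ne τ 10
  have nQ : Q ≠ 0 := by rw [hQ]; exact qq_ne_zero 1 τ
  have d1 : ModularForm.discriminant τ = Q * e1 ^ 24 := by rw [he1, hQ, pow_one, disc_eul]
  have d2 : ModularForm.discriminant (mulp 2 τ) = Q ^ 2 * e2 ^ 24 := by rw [he2, hQ, disc_mulp]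
  have d5 : ModularForm.discriminant (mulp 5 τ) = Q ^ 5 * e5 ^ 24 := by rw [he5, hQ, disc_mulp]
  have d10 : ModularForm.discriminant (mulp 10 τ) = Q ^ 10 * e10 ^ 24 := by
    rw [he10, hQ, disc_mulp]
  have u21 := h.up 2
  have u51 := h.up 5
  have u105 := (h.mulp 5).up 2
  have u102 := (h.mulp 2).up 5
  have v12 := h.down 2
  have v15 := h.down 5
  have v510 := (h.mulp 5).down 2
  have v210 := (h.mulp 2).down 5
  rw [mulp_mulp 2 5 10 rfl] at u105 v510
  rw [mulp_mulp 5 2 10 rfl] at u102 v210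
  rw [d2, d1] at u21 v12
  rw [d5, d1] at u51 v15
  rw [d10, d5] at u105 v510
  rw [d10, d2] at u102 v210
  push_cast at u21 u51 u105 u102
  have nQ' := hs ▸ nQ
  have ns : s ≠ 0 := by rintro rfl; simp at nQ'
  constructor
  · refine IsIntegral.of_pow (n := 12) (by norm_num) (?_ : x ^ 12 ∈ AI)
    refine bezout_mem ?_ ?_
    · convert mul_mem (mul_mem u105 v12) v15 using 1
      rw [hx]
      field_simp
    · convert mul_mem (mul_mem u102 v15) v15 using 1
      rw [hx]
      field_simp
  · have hs' : s ^ 24 = Q ^ 12 := by rw [← hs]; ring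
    have hy' : y ^ 24 = e2 ^ 48 * e5 ^ 24 / (Q ^ 12 * e1 ^ 24 * e10 ^ 48) := by
      rw [hy, ← hs']
      field_simp
    refine IsIntegral.of_pow (n := 24) (by norm_num) (?_ : y ^ 24 ∈ AI)
    refine bezout_mem ?_ ?_
    · convert mul_mem (mul_mem u21 v510) v210 using 1
      rw [hy']
      field_simp
    · convert mul_mem (mul_mem u51 v210) v210 using 1
      rw [hy']
      field_simp


end Part6

lemma qPoch_self (z : ℂ) : qPoch z z = eul z := by
  unfold qPoch eul
  simp only [pow_succ']

end EtaCM

/-- If `τ ∈ ℍ` is an imaginary quadratic point, then `1/g(τ)` and `1/U(τ)` are algebraic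
integers. -/
theorem statement17 (τ : UpperHalfPlane) (hτ : IsImagQuadratic τ) :
    IsIntegral ℤ (1 / gfun τ) ∧ IsIntegral ℤ (1 / Ufun τ) := by
  refine EtaCM.main_aux (τ := τ) hτ _ _ (Complex.exp (Real.pi * Complex.I * τ))
    (qPoch (Qc τ) (Qc τ)) (qPoch (Qc τ ^ 2) (Qc τ ^ 2)) (qPoch (Qc τ ^ 5) (Qc τ ^ 5))
    (qPoch (Qc τ ^ 10) (Qc τ ^ 10)) (Qc τ) ?_ ?_ ?_ ?_ ?_ ?_ rfl rfl
  · rw [EtaCM.qq_one, Function.Periodic.qParam, Qc]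
    simp
  · rw [pow_one]; exact EtaCM.qPoch_self _
  · exact EtaCM.qPoch_self _
  · exact EtaCM.qPoch_self _
  · exact EtaCM.qPoch_self _
  · rw [Qc, ← Complex.exp_nat_mul]
    congr 1
    push_cast
    ring
end
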